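/- arXiv:1210.0648 — 4 statements merged into one kernel-verified Lean document; each statement's English description precedes it below -/
import Mathlib

section
/- Fix m ∈ {3,4,6,∞} and n ≥ 2. Let P_n ∈ ℤ⟦t⟧ be the Poincaré series of the Coxeter group on n generators whose Coxeter matrix has every off-diagonal entry equal to m, and let P_2 be the Poincaré series of the corresponding rank-2 Coxeter group (same m). Then in ℤ⟦t⟧: ( ((n−1)(n−2)/2)·t·P_2 − ((n+1)(n−2)/2)·P_2 + (n(n−1)/2)·(1+t) ) · P_n = (1+t)·P_2. -/
open PowerSeries

/-- The Poincaré series of (the Coxeter group of) a Coxeter matrix: the generating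
function of the number of elements of each length in its Coxeter group. -/
noncomputable def coxPoincare {B : Type*} (M : CoxeterMatrix B) : PowerSeries ℤ :=
  PowerSeries.mk fun k =>
    (Nat.card {w : M.Group // M.toCoxeterSystem.length w = k} : ℤ)

namespace CoxConst

open CoxeterSystem

/-- Chebyshev-like sequence. -/
def cheb (c : ℝ) : ℕ → ℝ
  | 0 => 0
  | 1 => 1
  | (k + 2) => c * cheb c (k + 1) - cheb c k

/-- `c` plays the role of `2 cos (π / m)`. -/
def GoodC (m : ℕ) (c : ℝ) : Prop :=
  0 ≤ c ∧ ((m = 0 ∧ c = 2) ∨ (m = 3 ∧ c = 1) ∨ (m = 4 ∧ c ^ 2 = 2) ∨ (m = 6 ∧ c ^ 2 = 3))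

lemma exists_goodC {m : ℕ} (hm : m = 3 ∨ m = 4 ∨ m = 6 ∨ m = 0) : ∃ c, GoodC m c := by
  rcases hm with h | h | h | h
  · exact ⟨1, by norm_num, by simp [h]⟩
  · exact ⟨√2, by positivity, by simp [h]⟩
  · exact ⟨√3, by positivity, by simp [h]⟩
  · exact ⟨2, by norm_num, by simp [h]⟩

lemma GoodC.one_le {m : ℕ} {c : ℝ} (h : GoodC m c) : 1 ≤ c := by
  obtain ⟨h0, h | h | h | h⟩ := h
  · linarith
  · linarith
  · nlinarith
  · nlinarith

lemma cheb_two (k : ℕ) : cheb 2 k = k := by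
  induction k using Nat.twoStepInduction with
  | zero => simp [cheb]
  | one => simp [cheb]
  | more k h1 h2 => rw [cheb, h1, h2]; push_cast; ring

lemma cheb_nonneg {m : ℕ} {c : ℝ} (h : GoodC m c) (k : ℕ) (hk : m ≠ 0 → k ≤ m) :
    0 ≤ cheb c k := by
  obtain ⟨h0, ⟨rfl, rfl⟩ | ⟨rfl, rfl⟩ | ⟨rfl, h⟩ | ⟨rfl, h⟩⟩ := h
  · rw [cheb_two]; positivity
  · have : k ≤ 3 := hk (by norm_num)
    interval_cases k <;> norm_num [cheb]
  · have : k ≤ 4 := hk (by norm_num)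
    interval_cases k <;> norm_num [cheb] <;> nlinarith
  · have : k ≤ 6 := hk (by norm_num)
    have h4 : c ^ 4 = 9 := by nlinarith
    interval_cases k <;> norm_num [cheb] <;> ring_nf <;> nlinarith

variable {n : ℕ}

/-- the coroot functional -/
noncomputable def cor (c : ℝ) (i : Fin n) : (Fin n → ℝ) →ₗ[ℝ] ℝ :=
  (2 + c) • LinearMap.proj i - c • ∑ k, LinearMap.proj k

lemma cor_apply (c : ℝ) (i : Fin n) (x : Fin n → ℝ) :
    cor c i x = (2 + c) * x i - c * ∑ k, x k := by
  simp [cor]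

/-- simple root -/
abbrev e (i : Fin n) : Fin n → ℝ := Pi.single i 1

lemma cor_self (c : ℝ) (i : Fin n) : cor c i (e i) = 2 := by
  simp [cor_apply]

lemma cor_ne (c : ℝ) {i j : Fin n} (h : i ≠ j) : cor c i (e j) = -c := by
  simp [cor_apply, h]

/-- reflection -/
noncomputable def refl (c : ℝ) (i : Fin n) : Module.End ℝ (Fin n → ℝ) :=
  LinearMap.id - (cor c i).smulRight (e i)

lemma refl_apply (c : ℝ) (i : Fin n) (x : Fin n → ℝ) :
    refl c i x = x - cor c i x • e i := by
  simp [refl]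

lemma refl_self (c : ℝ) (i : Fin n) : refl c i (e i) = - e i := by
  rw [refl_apply, cor_self]; module

lemma refl_ne (c : ℝ) {i j : Fin n} (h : i ≠ j) : refl c i (e j) = e j + c • e i := by
  rw [refl_apply, cor_ne c h]; module

lemma refl_mul_self (c : ℝ) (i : Fin n) : refl c i * refl c i = 1 := by
  refine LinearMap.ext fun x => ?_
  simp only [Module.End.mul_apply, refl_apply, map_sub, map_smul, cor_self, Module.End.one_apply]
  module

lemma step (c : ℝ) {i j : Fin n} (h : i ≠ j) (x : Fin n → ℝ) (p q : ℝ) :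
    (refl c i * refl c j) (x + p • e i + q • e j) =
      x + (p - (cor c i x + 2 * p - c * (c * p - q - cor c j x))) • e i
        + (c * p - q - cor c j x) • e j := by
  simp only [Module.End.mul_apply, refl_apply, map_sub, map_smul, map_add, cor_self, cor_ne c h,
    cor_ne c h.symm,]
  module

lemma refl_braid {m : ℕ} {c : ℝ} (hc : GoodC m c) {i j : Fin n} (h : i ≠ j) :
    (refl c i * refl c j) ^ m = 1 := by
  refine LinearMap.ext fun x => ?_
  have hx : x = x + (0 : ℝ) • e i + (0 : ℝ) • e j := by simp
  have st := step c h x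
  rw [Module.End.one_apply]
  generalize refl c i * refl c j = T at *
  generalize cor c i x = f at *
  generalize cor c j x = g at *
  obtain ⟨h0, ⟨rfl, rfl⟩ | ⟨rfl, rfl⟩ | ⟨rfl, h'⟩ | ⟨rfl, h'⟩⟩ := hc
  · simp
  · conv_lhs => rw [hx]
    simp only [pow_succ, pow_zero, one_mul, Module.End.mul_apply, st]
    module
  · have st2 : ∀ p q : ℝ, (T ^ 2) (x + p • e i + q • e j) =
        x + (-2 * f - c * g - p) • e i + (-c * f - 2 * g - q) • e j := by
      intro p q
      simp only [pow_succ, pow_zero, one_mul, Module.End.mul_apply, st]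
      congr 1
      · congr 2
        linear_combination (c ^ 2 * p - c * q - c * g - f - p) * h'
      · congr 1
        linear_combination (c * p - g - q) * h'
    conv_lhs => rw [hx]
    rw [show 4 = 2 + 2 from rfl, pow_add, Module.End.mul_apply, st2, st2]
    module
  · have st2 : ∀ p q : ℝ, T (x + p • e i + q • e j) =
        x + (2 * p - c * q - f - c * g) • e i + (c * p - q - g) • e j := by
      intro p q
      rw [st]
      congr 3
      linear_combination p * h'
    have st3 : ∀ p q : ℝ, (T ^ 3) (x + p • e i + q • e j) =
        x + (-4 * f - 2 * c * g - p) • e i + (-2 * c * f - 4 * g - q) • e j := by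
      intro p q
      simp only [pow_succ, pow_zero, one_mul, Module.End.mul_apply, st2]
      congr 1
      · congr 2
        linear_combination (-3 * p + c * q + f + c * g) * h'
      · congr 1
        linear_combination (-c * p - g) * h'
    conv_lhs => rw [hx]
    rw [show 6 = 3 + 3 from rfl, pow_add, Module.End.mul_apply, st3, st3]
    module

lemma liftable {m : ℕ} {c : ℝ} (hc : GoodC m c) (M : CoxeterMatrix (Fin n))
    (hM : ∀ i j, i ≠ j → M i j = m) : M.IsLiftable (refl (n := n) c) := by
  intro i j
  by_cases h : i = j
  · subst h; rw [M.diagonal, pow_one, refl_mul_self]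
  · rw [hM i j h, refl_braid hc h]

section
variable {m : ℕ} {c : ℝ} (hc : GoodC m c) (M : CoxeterMatrix (Fin n))
    (hM : ∀ i j, i ≠ j → M i j = m)

/-- geometric representation -/
noncomputable def rho : M.Group →* Module.End ℝ (Fin n → ℝ) :=
  M.toCoxeterSystem.lift ⟨refl c, liftable hc M hM⟩

local notation "ρ" => rho hc M hM

lemma rho_simple (i : Fin n) : ρ (M.toCoxeterSystem.simple i) = refl c i :=
  CoxeterSystem.lift_apply_simple _ _ _

lemma rho_inj (w : M.Group) (x : Fin n → ℝ) (h : ρ w x = 0) : x = 0 := by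
  have : ρ (w⁻¹) (ρ w x) = x := by
    rw [← Module.End.mul_apply, ← map_mul]; simp
  rw [← this, h, map_zero]

lemma rho_alt {s t : Fin n} (h : s ≠ t) (r : ℕ) :
    ρ (M.toCoxeterSystem.wordProd (alternatingWord s t r)) (e s) =
      if Even r then cheb c (r + 1) • e s + cheb c r • e t
      else cheb c r • e s + cheb c (r + 1) • e t := by
  induction r with
  | zero => simp [alternatingWord, cheb]
  | succ r ih =>
    rw [alternatingWord_succ', wordProd_cons, map_mul, Module.End.mul_apply, ih, rho_simple]
    by_cases hr : Even r
    · simp only [hr, if_true, Nat.even_add_one, not_true, if_false, map_add, map_smul, refl_self,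
        refl_ne c h.symm, cheb]
      module
    · simp only [hr, if_true, Nat.even_add_one, not_false_eq_true, if_false, map_add, map_smul,
        refl_self, refl_ne c h, cheb]
      module

lemma rho_alt_comb {s t : Fin n} (h : s ≠ t) (r : ℕ) (hr : m ≠ 0 → r < m) :
    ∃ a b : ℝ, 0 ≤ a ∧ 0 ≤ b ∧
      ρ (M.toCoxeterSystem.wordProd (alternatingWord s t r)) (e s) = a • e s + b • e t := by
  have h1 := cheb_nonneg hc r (fun h => (hr h).le)
  have h2 := cheb_nonneg hc (r + 1) (fun h => hr h)
  rw [rho_alt hc M hM h]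
  split_ifs
  · exact ⟨_, _, h2, h1, rfl⟩
  · exact ⟨_, _, h1, h2, rfl⟩

lemma exists_decomp (L : ℕ) : ∀ (w : M.Group) (s t : Fin n), s ≠ t → M.toCoxeterSystem.length w = L →
    M.toCoxeterSystem.IsRightDescent w t → ∃ (r : ℕ) (v : M.Group), 1 ≤ r ∧
      w = v * M.toCoxeterSystem.wordProd (alternatingWord s t r) ∧ M.toCoxeterSystem.length w = M.toCoxeterSystem.length v + r ∧
      ¬ M.toCoxeterSystem.IsRightDescent v s ∧ ¬ M.toCoxeterSystem.IsRightDescent v t := by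
  induction L with
  | zero =>
    intro w s t _ hl hd
    unfold IsRightDescent at hd
    omega
  | succ L ih =>
    intro w s t hst hl hd
    have hd' := (M.toCoxeterSystem.isRightDescent_iff).1 hd
    have hnt : ¬ M.toCoxeterSystem.IsRightDescent (w * M.toCoxeterSystem.simple t) t :=
      (M.toCoxeterSystem.isRightDescent_iff_not_isRightDescent_mul).1 hd
    by_cases hs : M.toCoxeterSystem.IsRightDescent (w * M.toCoxeterSystem.simple t) s
    · obtain ⟨r, v, hr, hw, hlen, h1, h2⟩ := ih (w * M.toCoxeterSystem.simple t) t s hst.symm (by omega) hs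
      refine ⟨r + 1, v, by omega, ?_, by omega, h2, h1⟩
      rw [alternatingWord_succ, wordProd_concat, ← mul_assoc, ← hw,
        simple_mul_simple_cancel_right]
    · exact ⟨1, w * M.toCoxeterSystem.simple t, le_rfl, by
        simp only [alternatingWord, List.concat_eq_append, List.nil_append, wordProd_singleton]
        rw [simple_mul_simple_cancel_right], by omega, hs, hnt⟩

lemma tits (L : ℕ) : ∀ (w : M.Group) (s : Fin n), M.toCoxeterSystem.length w = L →
    ¬ M.toCoxeterSystem.IsRightDescent w s → 0 ≤ ρ w (e s) := by
  induction L using Nat.strong_induction_on with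
  | _ L ih =>
    intro w s hl hd
    by_cases hw : w = 1
    · subst hw
      simp
    obtain ⟨t, ht⟩ := M.toCoxeterSystem.exists_rightDescent_of_ne_one hw
    have hst : s ≠ t := by rintro rfl; exact hd ht
    obtain ⟨r, v, hr, hw, hlen, h1, h2⟩ := exists_decomp M _ w s t hst rfl ht
    have p1 := ih (M.toCoxeterSystem.length v) (by omega) v s rfl h1
    have p2 := ih (M.toCoxeterSystem.length v) (by omega) v t rfl h2
    have hrm : m ≠ 0 → r < m := by
      intro hm
      by_contra hcon
      have hM' : M t s = m := hM t s hst.symm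
      have hnr := M.toCoxeterSystem.not_isReduced_alternatingWord t s (m := r + 1) (by rw [hM']; exact hm)
        (by rw [hM']; omega)
      apply hnr
      unfold CoxeterSystem.IsReduced
      have hle := M.toCoxeterSystem.length_wordProd_le (alternatingWord t s (r + 1))
      have e1 := (M.toCoxeterSystem.not_isRightDescent_iff).1 hd
      have e2 : w * M.toCoxeterSystem.simple s = v * M.toCoxeterSystem.wordProd (alternatingWord t s (r + 1)) := by
        rw [alternatingWord_succ, wordProd_concat, ← mul_assoc, ← hw]
      have e3 := M.toCoxeterSystem.length_mul_le v (M.toCoxeterSystem.wordProd (alternatingWord t s (r + 1)))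
      rw [← e2] at e3
      rw [length_alternatingWord] at hle ⊢
      omega
    obtain ⟨a, b, ha, hb, hab⟩ := rho_alt_comb hc M hM hst r hrm
    rw [hw, map_mul, Module.End.mul_apply, hab, map_add, map_smul, map_smul]
    exact add_nonneg (smul_nonneg ha p1) (smul_nonneg hb p2)

lemma nonneg_of_not_desc {w : M.Group} {s : Fin n} (h : ¬ M.toCoxeterSystem.IsRightDescent w s) :
    0 ≤ ρ w (e s) := tits hc M hM _ w s rfl h

lemma nonpos_of_desc {w : M.Group} {s : Fin n} (h : M.toCoxeterSystem.IsRightDescent w s) :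
    ρ w (e s) ≤ 0 := by
  have := nonneg_of_not_desc hc M hM ((M.toCoxeterSystem.isRightDescent_iff_not_isRightDescent_mul).1 h)
  rw [map_mul, Module.End.mul_apply, rho_simple, refl_self, map_neg] at this
  exact neg_nonneg.1 this

lemma e_ne (s : Fin n) : e s ≠ 0 := by
  intro h
  have := congrFun h s
  simp at this

lemma desc_of_nonpos {w : M.Group} {s : Fin n} (h : ρ w (e s) ≤ 0) :
    M.toCoxeterSystem.IsRightDescent w s := by
  by_contra h'
  have := nonneg_of_not_desc hc M hM h'
  exact e_ne s (rho_inj hc M hM w _ (le_antisymm h this))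

lemma not_desc_of_nonneg {w : M.Group} {s : Fin n} (h : 0 ≤ ρ w (e s)) :
    ¬ M.toCoxeterSystem.IsRightDescent w s := by
  intro h'
  have := nonpos_of_desc hc M hM h'
  exact e_ne s (rho_inj hc M hM w _ (le_antisymm this h))

lemma antidom (x : Fin n → ℝ) (hx : ∀ l, cor c l x ≤ 0) (L : ℕ) :
    ∀ w : M.Group, M.toCoxeterSystem.length w = L → x ≤ ρ w x := by
  induction L with
  | zero =>
    intro w hw
    rw [M.toCoxeterSystem.length_eq_zero_iff] at hw
    subst hw
    simp
  | succ L ih =>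
    intro w hw
    have hw1 : w ≠ 1 := by rintro rfl; simp at hw
    obtain ⟨t, ht⟩ := M.toCoxeterSystem.exists_rightDescent_of_ne_one hw1
    have hd' := (M.toCoxeterSystem.isRightDescent_iff).1 ht
    have i1 := ih (w * M.toCoxeterSystem.simple t) (by omega)
    have i2 := nonpos_of_desc hc M hM ht
    rw [map_mul, Module.End.mul_apply, rho_simple, refl_apply, map_sub, map_smul] at i1
    have i3 : 0 ≤ cor c t x • ρ w (e t) := smul_nonneg_of_nonpos_of_nonpos (hx t) i2
    exact i1.trans (sub_le_self _ i3)

include hc hM in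
lemma no_desc (J : Finset (Fin n)) (hJ : J.Nonempty)
    (hx : ∀ l, cor c l (∑ i ∈ J, e i) ≤ 0) (w : M.Group) :
    ¬ ∀ i ∈ J, M.toCoxeterSystem.IsRightDescent w i := by
  intro h
  have h1 := antidom hc M hM _ hx _ w rfl
  have h2 : ρ w (∑ i ∈ J, e i) ≤ 0 := by
    rw [map_sum]
    exact Finset.sum_nonpos fun i hi => nonpos_of_desc hc M hM (h i hi)
  obtain ⟨j, hj⟩ := hJ
  have h3 := (h1.trans h2) j
  simp [Finset.sum_apply, Pi.single_apply, hj] at h3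
  linarith

lemma cor_sum (J : Finset (Fin n)) (l : Fin n) :
    cor c l (∑ i ∈ J, e i) = (2 + c) * (if l ∈ J then 1 else 0) - c * J.card := by
  rw [map_sum]
  simp only [cor_apply]
  rw [Finset.sum_sub_distrib, ← Finset.mul_sum]
  simp [Pi.single_apply, mul_comm]

include hc hM in
lemma card_desc_le (J : Finset (Fin n)) (w : M.Group) (h : ∀ i ∈ J, M.toCoxeterSystem.IsRightDescent w i) :
    J.card ≤ 2 := by
  by_contra hcard
  refine no_desc hc M hM J (Finset.card_pos.1 (by omega)) (fun l => ?_) w h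
  rw [cor_sum]
  have h1 := hc.one_le
  have h2 : (3 : ℝ) ≤ J.card := by exact_mod_cast (by omega : 3 ≤ J.card)
  split_ifs <;> nlinarith

include hc hM in
lemma no_two_desc (hm : m = 0) {i j : Fin n} (hij : i ≠ j) (w : M.Group)
    (hi : M.toCoxeterSystem.IsRightDescent w i) (hj : M.toCoxeterSystem.IsRightDescent w j) : False := by
  have hc2 : c = 2 := by
    obtain ⟨-, h | h | h | h⟩ := hc
    · exact h.2
    all_goals omega
  refine no_desc hc M hM {i, j} (by simp) (fun l => ?_) w (by simp [hi, hj])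
  rw [cor_sum, Finset.card_pair hij, hc2]
  split_ifs <;> norm_num

include hc hM in
lemma len_down (w : M.Group) (r : ℕ) (hr : m ≠ 0 → r ≤ m) : ∀ {a b : Fin n}, a ≠ b →
    M.toCoxeterSystem.IsRightDescent w a → M.toCoxeterSystem.IsRightDescent w b →
    M.toCoxeterSystem.length (w * M.toCoxeterSystem.wordProd (alternatingWord a b r)) + r = M.toCoxeterSystem.length w := by
  induction r with
  | zero => simp [alternatingWord]
  | succ r ih =>
    intro a b hab ha hb
    have h1 := ih (fun h => (Nat.le_succ _).trans (hr h)) hab.symm hb ha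
    obtain ⟨x, y, hx, hy, hxy⟩ := rho_alt_comb hc M hM hab.symm r hr
    have h2 : M.toCoxeterSystem.IsRightDescent (w * M.toCoxeterSystem.wordProd (alternatingWord b a r)) b := by
      apply desc_of_nonpos hc M hM
      rw [map_mul, Module.End.mul_apply, hxy, map_add, map_smul, map_smul]
      exact add_nonpos (smul_nonpos_of_nonneg_of_nonpos hx (nonpos_of_desc hc M hM hb))
        (smul_nonpos_of_nonneg_of_nonpos hy (nonpos_of_desc hc M hM ha))
    have h3 := (M.toCoxeterSystem.isRightDescent_iff).1 h2
    rw [alternatingWord_succ, wordProd_concat, ← mul_assoc]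
    omega

include hc hM in
lemma len_up (w : M.Group) (r : ℕ) (hr : m ≠ 0 → r ≤ m) : ∀ {a b : Fin n}, a ≠ b →
    ¬ M.toCoxeterSystem.IsRightDescent w a → ¬ M.toCoxeterSystem.IsRightDescent w b →
    M.toCoxeterSystem.length (w * M.toCoxeterSystem.wordProd (alternatingWord a b r)) = M.toCoxeterSystem.length w + r := by
  induction r with
  | zero => simp [alternatingWord]
  | succ r ih =>
    intro a b hab ha hb
    have h1 := ih (fun h => (Nat.le_succ _).trans (hr h)) hab.symm hb ha
    obtain ⟨x, y, hx, hy, hxy⟩ := rho_alt_comb hc M hM hab.symm r hr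
    have h2 : ¬ M.toCoxeterSystem.IsRightDescent (w * M.toCoxeterSystem.wordProd (alternatingWord b a r)) b := by
      apply not_desc_of_nonneg hc M hM
      rw [map_mul, Module.End.mul_apply, hxy, map_add, map_smul, map_smul]
      exact add_nonneg (smul_nonneg hx (nonneg_of_not_desc hc M hM hb))
        (smul_nonneg hy (nonneg_of_not_desc hc M hM ha))
    have h3 := (M.toCoxeterSystem.not_isRightDescent_iff).1 h2
    rw [alternatingWord_succ, wordProd_concat, ← mul_assoc]
    omega

include hM in
lemma alt_comm {a b : Fin n} (hab : a ≠ b) :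
    M.toCoxeterSystem.wordProd (alternatingWord a b m) = M.toCoxeterSystem.wordProd (alternatingWord b a m) := by
  have := M.toCoxeterSystem.wordProd_braidWord_eq a b
  unfold braidWord at this
  rwa [hM a b hab, hM b a hab.symm] at this

include hc hM in
lemma flip_up (hm : m ≠ 0) (w : M.Group) {a b : Fin n} (hab : a ≠ b)
    (ha : ¬ M.toCoxeterSystem.IsRightDescent w a) (hb : ¬ M.toCoxeterSystem.IsRightDescent w b) :
    M.toCoxeterSystem.IsRightDescent (w * M.toCoxeterSystem.wordProd (alternatingWord a b m)) b := by
  obtain ⟨k, rfl⟩ := Nat.exists_eq_succ_of_ne_zero hm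
  unfold IsRightDescent
  rw [len_up hc M hM w _ (fun _ => le_rfl) hab ha hb, Nat.succ_eq_add_one, alternatingWord_succ,
    wordProd_concat, ← mul_assoc, simple_mul_simple_cancel_right,
    len_up hc M hM w k (fun _ => Nat.le_succ k) hab.symm hb ha]
  omega

include hc hM in
lemma flip_down (hm : m ≠ 0) (w : M.Group) {a b : Fin n} (hab : a ≠ b)
    (ha : M.toCoxeterSystem.IsRightDescent w a) (hb : M.toCoxeterSystem.IsRightDescent w b) :
    ¬ M.toCoxeterSystem.IsRightDescent (w * M.toCoxeterSystem.wordProd (alternatingWord a b m)) b := by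
  obtain ⟨k, rfl⟩ := Nat.exists_eq_succ_of_ne_zero hm
  unfold IsRightDescent
  have h1 := len_down hc M hM w _ (fun _ => le_rfl) hab ha hb
  have h2 := len_down hc M hM w k (fun _ => Nat.le_succ k) hab.symm hb ha
  rw [Nat.succ_eq_add_one, alternatingWord_succ, wordProd_concat, ← mul_assoc] at h1 ⊢
  rw [simple_mul_simple_cancel_right]
  omega

end

section counting

variable (M : CoxeterMatrix (Fin n))

lemma lv_finite (k : ℕ) : {w : M.Group | M.toCoxeterSystem.length w = k}.Finite := by
  refine ((List.finite_length_eq (Fin n) k).image M.toCoxeterSystem.wordProd).subset ?_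
  intro w hw
  obtain ⟨l, hl, rfl⟩ := M.toCoxeterSystem.exists_isReduced w
  exact ⟨l, hl.symm.trans hw, rfl⟩

/-- elements of length k -/
noncomputable def lv (k : ℕ) : Finset M.Group := (lv_finite M k).toFinset

lemma mem_lv {k : ℕ} {w : M.Group} : w ∈ lv M k ↔ M.toCoxeterSystem.length w = k := by
  simp [lv]

/-- weighted generating function -/
noncomputable def G (f : M.Group → ℤ) : PowerSeries ℤ :=
  PowerSeries.mk fun k => ∑ w ∈ lv M k, f w

lemma G_one : G M (fun _ => 1) = coxPoincare M := by
  unfold G coxPoincare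
  congr 1
  funext k
  rw [Finset.sum_const, nsmul_eq_mul, mul_one]
  congr 1
  exact (Nat.subtype_card (lv M k) (fun w => mem_lv M)).symm

lemma G_add (f g : M.Group → ℤ) : G M (fun w => f w + g w) = G M f + G M g := by
  ext k; simp [G, Finset.sum_add_distrib]

lemma G_sub (f g : M.Group → ℤ) : G M (fun w => f w - g w) = G M f - G M g := by
  ext k; simp [G, Finset.sum_sub_distrib]

lemma G_sum {ι : Type*} (s : Finset ι) (f : ι → M.Group → ℤ) :
    G M (fun w => ∑ i ∈ s, f i w) = ∑ i ∈ s, G M (f i) := by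
  ext k; simp only [G, map_sum, coeff_mk]; exact Finset.sum_comm

open Classical in
lemma G_id : G M (fun w => if w = 1 then 1 else 0) = 1 := by
  ext k
  simp only [G, coeff_mk, coeff_one, Finset.sum_ite_eq', mem_lv, length_one]
  simp [eq_comm]

open Classical in
/-- indicator generating function -/
noncomputable def GI (S : M.Group → Prop) : PowerSeries ℤ := G M (fun w => if S w then 1 else 0)

lemma GI_shift (S T : M.Group → Prop) (d : M.Group) (m : ℕ)
    (h1 : ∀ w, S w → T (w * d) ∧ M.toCoxeterSystem.length (w * d) = M.toCoxeterSystem.length w + m)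
    (h2 : ∀ w, T w → S (w * d) ∧
      M.toCoxeterSystem.length (w * d) + m = M.toCoxeterSystem.length w) :
    GI M T = X ^ m * GI M S := by
  classical
  ext k
  rw [coeff_X_pow_mul']
  simp only [GI, G, coeff_mk, Finset.sum_boole]
  split_ifs with hk
  · congr 1
    apply le_antisymm
    · refine Finset.card_le_card_of_injOn (fun w => w * d) ?_ ((mul_left_injective d).injOn)
      intro w hw
      simp only [Finset.coe_filter, mem_lv, Set.mem_ofPred_eq] at hw ⊢
      have := h2 w hw.2
      exact ⟨by omega, this.1⟩
    · refine Finset.card_le_card_of_injOn (fun w => w * d) ?_ ((mul_left_injective d).injOn)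
      intro w hw
      simp only [Finset.coe_filter, mem_lv, Set.mem_ofPred_eq] at hw ⊢
      have := h1 w hw.2
      exact ⟨by omega, this.1⟩
  · rw [Finset.card_eq_zero.2, Nat.cast_zero]
    apply Finset.filter_eq_empty_iff.2
    intro w hw hT
    rw [mem_lv] at hw
    have := (h2 w hT).2
    omega

/-- neither descents -/
noncomputable def NA (i j : Fin n) : PowerSeries ℤ :=
  GI M (fun w => ¬ M.toCoxeterSystem.IsRightDescent w i ∧ ¬ M.toCoxeterSystem.IsRightDescent w j)

/-- both descents -/
noncomputable def NB (i j : Fin n) : PowerSeries ℤ :=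
  GI M (fun w => M.toCoxeterSystem.IsRightDescent w i ∧ M.toCoxeterSystem.IsRightDescent w j)

/-- nondescent -/
noncomputable def NN (i : Fin n) : PowerSeries ℤ :=
  GI M (fun w => ¬ M.toCoxeterSystem.IsRightDescent w i)

/-- descent -/
noncomputable def ND (i : Fin n) : PowerSeries ℤ :=
  GI M (fun w => M.toCoxeterSystem.IsRightDescent w i)

lemma ND_eq (i : Fin n) : ND M i = X * NN M i := by
  have := GI_shift M (fun w => ¬ M.toCoxeterSystem.IsRightDescent w i)
    (fun w => M.toCoxeterSystem.IsRightDescent w i) (M.toCoxeterSystem.simple i) 1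
    (fun w hw => ⟨?_, ?_⟩) (fun w hw => ⟨?_, ?_⟩)
  · rw [pow_one] at this; exact this
  · by_contra h
    exact hw (M.toCoxeterSystem.isRightDescent_iff_not_isRightDescent_mul.2 h)
  · exact M.toCoxeterSystem.not_isRightDescent_iff.1 hw
  · exact M.toCoxeterSystem.isRightDescent_iff_not_isRightDescent_mul.1 hw
  · exact M.toCoxeterSystem.isRightDescent_iff.1 hw

lemma NN_add_ND (i : Fin n) : NN M i + ND M i = coxPoincare M := by
  rw [← G_one, NN, ND, GI, GI, ← G_add]
  congr 1; funext w
  split_ifs <;> simp_all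

lemma NN_mul (i : Fin n) : (1 + X) * NN M i = coxPoincare M := by
  rw [← NN_add_ND M i, ND_eq]; ring

lemma incl_excl (i j : Fin n) : NB M i j = coxPoincare M - NN M i - NN M j + NA M i j := by
  rw [← G_one, NN, NN, NA, NB, GI, GI, GI, GI, ← G_sub, ← G_sub, ← G_add]
  congr 1; funext w
  by_cases h1 : M.toCoxeterSystem.IsRightDescent w i <;>
  by_cases h2 : M.toCoxeterSystem.IsRightDescent w j <;> simp [h1, h2]

/-- `t^m`, with `t^∞ = 0`. -/
noncomputable def eps (m : ℕ) : PowerSeries ℤ := if m = 0 then 0 else X ^ m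

section
variable {m : ℕ} {c : ℝ} (hc : GoodC m c) (hM : ∀ i j, i ≠ j → M i j = m)

include hc hM

lemma NB_eq {i j : Fin n} (hij : i ≠ j) : NB M i j = eps m * NA M i j := by
  unfold eps
  split_ifs with hm
  · rw [zero_mul, NB, GI]
    ext k
    simp only [G, coeff_mk, map_zero]
    refine Finset.sum_eq_zero fun w _ => ?_
    rw [if_neg]
    rintro ⟨h1, h2⟩
    exact no_two_desc hc M hM hm hij w h1 h2
  · refine GI_shift M _ _ (M.toCoxeterSystem.wordProd (alternatingWord i j m)) m
      (fun w hw => ⟨⟨?_, ?_⟩, ?_⟩) (fun w hw => ⟨⟨?_, ?_⟩, ?_⟩)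
    · rw [alt_comm M hM hij]; exact flip_up hc M hM hm w hij.symm hw.2 hw.1
    · exact flip_up hc M hM hm w hij hw.1 hw.2
    · exact len_up hc M hM w m (fun _ => le_rfl) hij hw.1 hw.2
    · rw [alt_comm M hM hij]; exact flip_down hc M hM hm w hij.symm hw.2 hw.1
    · exact flip_down hc M hM hm w hij hw.1 hw.2
    · exact len_down hc M hM w m (fun _ => le_rfl) hij hw.1 hw.2

lemma NA_eq {i j : Fin n} (hij : i ≠ j) :
    (X - 1) * coxPoincare M = (eps m - 1) * (1 + X) * NA M i j := by
  have h1 := incl_excl M i j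
  have h2 := NB_eq M hc hM hij
  have h3 := NN_mul M i
  have h4 := NN_mul M j
  linear_combination (-(1 + X)) * h1 + (1 + X) * h2 + h3 + h4

lemma total : 2 * coxPoincare M = 2 + 2 * ∑ i, ND M i
    - ∑ p ∈ (Finset.univ : Finset (Fin n)).offDiag, NB M p.1 p.2 := by
  classical
  have key : ∀ w : M.Group, (1 : ℤ) + 1 = (if w = 1 then 1 else 0) + (if w = 1 then 1 else 0) +
      (∑ i, (if M.toCoxeterSystem.IsRightDescent w i then 1 else 0) +
       ∑ i, (if M.toCoxeterSystem.IsRightDescent w i then 1 else 0))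
      - ∑ p ∈ (Finset.univ : Finset (Fin n)).offDiag,
        (if M.toCoxeterSystem.IsRightDescent w p.1 ∧ M.toCoxeterSystem.IsRightDescent w p.2
          then 1 else 0) := by
    intro w
    set D := Finset.univ.filter (fun i => M.toCoxeterSystem.IsRightDescent w i) with hD
    have e1 : ∑ i, (if M.toCoxeterSystem.IsRightDescent w i then (1 : ℤ) else 0) = D.card := by
      rw [Finset.sum_boole]
    have e2 : ∑ p ∈ (Finset.univ : Finset (Fin n)).offDiag,
        (if M.toCoxeterSystem.IsRightDescent w p.1 ∧ M.toCoxeterSystem.IsRightDescent w p.2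
          then (1 : ℤ) else 0) = D.offDiag.card := by
      rw [Finset.sum_boole]
      congr 2
      ext p
      simp [hD]
      tauto
    rw [e1, e2, Finset.offDiag_card]
    have hle : D.card ≤ 2 := card_desc_le hc M hM D w (by simp [hD])
    have h0 : D.card = 0 ↔ w = 1 := by
      rw [Finset.card_eq_zero, hD, Finset.filter_eq_empty_iff]
      constructor
      · intro h
        by_contra hw
        obtain ⟨i, hi⟩ := M.toCoxeterSystem.exists_rightDescent_of_ne_one hw
        exact h (Finset.mem_univ i) hi
      · rintro rfl i _
        exact M.toCoxeterSystem.not_isRightDescent_one i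
    by_cases hw : w = 1
    · have := h0.2 hw
      simp [hw, this]
    · have : D.card ≠ 0 := fun h => hw (h0.1 h)
      have : D.card = 1 ∨ D.card = 2 := by omega
      rcases this with h | h <;> simp [hw, h]
  have := congrArg (G M) (funext key)
  rw [G_sub, G_add, G_add, G_add, G_add, G_sum, G_sum, G_id, G_one] at this
  rw [two_mul, this]
  simp only [ND, NB, GI]
  ring

end

end counting

lemma NA_two (M : CoxeterMatrix (Fin 2)) : NA M 0 1 = 1 := by
  classical
  rw [← G_id M, NA, GI]
  congr 1
  funext w
  congr 1
  apply propext
  constructor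
  · rintro ⟨h0, h1⟩
    by_contra hw
    obtain ⟨i, hi⟩ := M.toCoxeterSystem.exists_rightDescent_of_ne_one hw
    fin_cases i
    · exact h0 hi
    · exact h1 hi
  · rintro rfl
    exact ⟨M.toCoxeterSystem.not_isRightDescent_one 0, M.toCoxeterSystem.not_isRightDescent_one 1⟩

end CoxConst

open CoxConst in
/-- for a Coxeter matrix on `n ≥ 2` generators all of whose off-diagonal
entries equal a fixed `m ∈ {3, 4, 6, ∞}` (with `∞` encoded as `0`), the Poincaré series
`P_n` satisfies
`(((n−1)(n−2)/2)·t·P₂ − ((n+1)(n−2)/2)·P₂ + (n(n−1)/2)·(1+t))·P_n = (1+t)·P₂`,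
where `P₂` is the Poincaré series of the corresponding rank-2 Coxeter group. -/
theorem poincare_const_coxeter_matrix (m n : ℕ) (hm : m = 3 ∨ m = 4 ∨ m = 6 ∨ m = 0)
    (hn : 2 ≤ n)
    (M : CoxeterMatrix (Fin n)) (hM : ∀ i j, i ≠ j → M i j = m)
    (M₂ : CoxeterMatrix (Fin 2)) (hM₂ : ∀ i j, i ≠ j → M₂ i j = m) :
    ((((n - 1) * (n - 2) / 2 : ℕ) : PowerSeries ℤ) * X * coxPoincare M₂
        - (((n + 1) * (n - 2) / 2 : ℕ) : PowerSeries ℤ) * coxPoincare M₂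
        + ((n * (n - 1) / 2 : ℕ) : PowerSeries ℤ) * (1 + X)) * coxPoincare M
      = (1 + X) * coxPoincare M₂ := by
  obtain ⟨c, hc⟩ := exists_goodC hm
  have hX : (X - 1 : PowerSeries ℤ) ≠ 0 := by
    intro h
    have := congrArg (coeff 0) h
    simp at this
  have h2 := NA_eq M₂ hc hM₂ (i := 0) (j := 1) (by decide)
  rw [NA_two, mul_one] at h2
  have hA : ∀ i j : Fin n, i ≠ j → NA M i j * coxPoincare M₂ = coxPoincare M := by
    intro i j hij
    apply mul_left_cancel₀ hX
    rw [NA_eq M hc hM hij, ← h2]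
    ring
  have hN := NN_mul M
  have htot := total M hc hM
  have s1 : (1 + X) * ∑ i, ND M i = (n : PowerSeries ℤ) * (X * coxPoincare M) := by
    rw [Finset.mul_sum, Finset.sum_congr rfl (g := fun _ => X * coxPoincare M)]
    · simp
    · intro i _
      rw [ND_eq, ← hN i]; ring
  have s2 : (1 + X) * coxPoincare M₂ *
      ∑ p ∈ (Finset.univ : Finset (Fin n)).offDiag, NB M p.1 p.2 =
      ((n * n - n : ℕ) : PowerSeries ℤ) * ((1 + X) * coxPoincare M₂ * coxPoincare M
        - 2 * (coxPoincare M₂ * coxPoincare M) + (1 + X) * coxPoincare M) := by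
    rw [Finset.mul_sum, Finset.sum_congr rfl (g := fun _ =>
      ((1 + X) * coxPoincare M₂ * coxPoincare M
        - 2 * (coxPoincare M₂ * coxPoincare M) + (1 + X) * coxPoincare M))]
    · rw [Finset.sum_const, Finset.offDiag_card, nsmul_eq_mul]
      simp
    · rintro ⟨i, j⟩ hp
      have hij : i ≠ j := by simpa using hp
      rw [incl_excl]
      linear_combination (-coxPoincare M₂) * hN i + (-coxPoincare M₂) * hN j
        + (1 + X) * hA i j hij
  generalize coxPoincare M = P at *
  generalize coxPoincare M₂ = Q at *
  obtain ⟨k, rfl⟩ := Nat.exists_eq_add_of_le hn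
  have d1 : 2 * ((((2 + k) - 1) * ((2 + k) - 2) / 2 : ℕ) : PowerSeries ℤ) = (k + 1) * k := by
    have : 2 * (((2 + k) - 1) * ((2 + k) - 2) / 2) = (k + 1) * k := by
      rw [show 2 + k - 1 = k + 1 by omega, show 2 + k - 2 = k by omega, mul_comm (k + 1)]
      exact Nat.mul_div_cancel' (Nat.even_mul_succ_self k).two_dvd
    have t := congrArg (fun z : ℕ => (z : PowerSeries ℤ)) this
    simp only [Nat.cast_mul 2, Nat.cast_ofNat] at t
    rw [t]
    push_cast
    ring
  have d2 : 2 * ((((2 + k) + 1) * ((2 + k) - 2) / 2 : ℕ) : PowerSeries ℤ) = (k + 3) * k := by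
    have : 2 * (((2 + k) + 1) * ((2 + k) - 2) / 2) = (k + 3) * k := by
      rw [show 2 + k + 1 = k + 3 by omega, show 2 + k - 2 = k by omega]
      apply Nat.mul_div_cancel'
      have := (Nat.even_mul_succ_self k).two_dvd
      rw [show (k + 3) * k = k * (k + 1) + 2 * k by ring]
      omega
    have t := congrArg (fun z : ℕ => (z : PowerSeries ℤ)) this
    simp only [Nat.cast_mul 2, Nat.cast_ofNat] at t
    rw [t]
    push_cast
    ring
  have d3 : 2 * (((2 + k) * ((2 + k) - 1) / 2 : ℕ) : PowerSeries ℤ) = (k + 2) * (k + 1) := by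
    have : 2 * ((2 + k) * ((2 + k) - 1) / 2) = (k + 2) * (k + 1) := by
      rw [show 2 + k - 1 = k + 1 by omega, show 2 + k = k + 1 + 1 by omega, mul_comm (k + 1 + 1)]
      rw [Nat.mul_div_cancel' (Nat.even_mul_succ_self (k + 1)).two_dvd]
    have t := congrArg (fun z : ℕ => (z : PowerSeries ℤ)) this
    simp only [Nat.cast_mul 2, Nat.cast_ofNat] at t
    rw [t]
    push_cast
    ring
  have d4 : (((2 + k) * (2 + k) - (2 + k) : ℕ) : PowerSeries ℤ) = (k + 2) * (k + 1) := by
    have : (2 + k) * (2 + k) - (2 + k) = (k + 2) * (k + 1) := by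
      rw [Nat.sub_eq_iff_eq_add (by nlinarith)]
      ring
    rw [this]
    push_cast
    ring
  rw [d4] at s2
  push_cast at s1
  have h20 : (2 : PowerSeries ℤ) ≠ 0 := by
    intro h
    have := congrArg (constantCoeff (R := ℤ)) h
    rw [map_ofNat, map_zero] at this
    norm_num at this
  apply mul_left_cancel₀ h20
  linear_combination X * Q * P * d1 - Q * P * d2 + (1 + X) * P * d3
    + (1 + X) * Q * htot + 2 * Q * s1 - s2
end

section
/- Let A=(a_{ij}) be an n×n generalized Cartan matrix with n ≥ 2 such that a_{ij}a_{ji}=1 for all i≠j (equivalently, every off-diagonal Coxeter matrix entry equals 3). Then in ℤ⟦t⟧: ( ((n−1)(n−2)/2)·t³ − (n−2)·t² − (n−2)·t + 1 ) · P(A) = (1+t)(1+t+t²). -/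
open PowerSeries

/-- `A` is a generalized Cartan matrix. -/
structure IsGCM {n : ℕ} (A : Matrix (Fin n) (Fin n) ℤ) : Prop where
  diag : ∀ i, A i i = 2
  nonpos : ∀ i j, i ≠ j → A i j ≤ 0
  zero_symm : ∀ i j, A i j = 0 → A j i = 0

/-- The Coxeter matrix entry associated to the product `aᵢⱼ·aⱼᵢ`:
it is `2, 3, 4, 6, ∞` according as the product is `0, 1, 2, 3, ≥ 4`
(`0` encodes `∞`, as in Mathlib's convention for `CoxeterMatrix`). -/
def gcmEntry (p : ℤ) : ℕ :=
  if p = 0 then 2 else if p = 1 then 3 else if p = 2 then 4 else if p = 3 then 6 else 0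

/-- The Coxeter matrix of a generalized Cartan matrix. -/
def gcmCoxeter {n : ℕ} (A : Matrix (Fin n) (Fin n) ℤ) : CoxeterMatrix (Fin n) where
  M := Matrix.of fun i j => if i = j then 1 else gcmEntry (A i j * A j i)
  isSymm := by
    ext i j
    simp only [Matrix.transpose_apply, Matrix.of_apply]
    rcases eq_or_ne i j with h | h
    · simp [h]
    · rw [if_neg h.symm, if_neg h, mul_comm]
  diagonal i := by simp
  off_diagonal i j h := by
    rw [Matrix.of_apply, if_neg h]
    unfold gcmEntry
    split_ifs <;> omega

section Aux

open CoxeterSystem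

variable {B W : Type*} [Fintype B] [DecidableEq B] [Group W] {M : CoxeterMatrix B}

/-- simple reflection in the geometric representation -/
def auxRefl (i : B) : Module.End ℤ (B → ℤ) where
  toFun v := v + Pi.single i (∑ k, v k - 3 * v i)
  map_add' v w := by
    ext k
    by_cases hk : k = i
    · subst hk; simp [Finset.sum_add_distrib]; ring
    · simp [hk]
  map_smul' c v := by
    ext k
    by_cases hk : k = i
    · subst hk; simp [← Finset.mul_sum]; ring
    · simp [hk]

theorem auxRefl_apply (i : B) (v : B → ℤ) :
    auxRefl i v = v + Pi.single i (∑ k, v k - 3 * v i) := rfl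

theorem auxRefl_sq (i : B) : auxRefl i * auxRefl i = 1 := by
  apply LinearMap.ext
  intro v
  ext k
  simp only [Module.End.mul_apply, auxRefl_apply, Module.End.one_apply, Pi.add_apply,
    Finset.sum_add_distrib, Finset.sum_pi_single', Finset.mem_univ, if_true, Pi.single_eq_same]
  by_cases hk : k = i
  · subst hk; simp; ring
  · simp [hk]

theorem auxRefl_braid (i j : B) (hij : i ≠ j) :
    auxRefl i * auxRefl j * auxRefl i = auxRefl j * auxRefl i * auxRefl j := by
  apply LinearMap.ext
  intro v
  ext k
  simp only [Module.End.mul_apply, auxRefl_apply, Pi.add_apply,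
    Finset.sum_add_distrib, Finset.sum_pi_single', Finset.mem_univ, if_true, Pi.single_eq_same,
    Pi.single_eq_of_ne hij, Pi.single_eq_of_ne hij.symm]
  by_cases hk : k = i
  · subst hk; simp [hij]; ring
  · by_cases hk' : k = j
    · subst hk'; simp [hk]; ring
    · simp [hk, hk']

theorem exists_rt (cs : CoxeterSystem M W) (hM : ∀ i j, i ≠ j → M i j = 3) :
    ∃ rt : W → B → (B → ℤ), (∀ w i, rt (w * cs.simple i) i = - rt w i) ∧
      (∀ w i j, i ≠ j → rt (w * cs.simple i) j = rt w j + rt w i) ∧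
      (∀ i, 0 ≤ rt 1 i) ∧ (∀ w i, rt w i ≠ 0) := by
  have hl : M.IsLiftable (auxRefl (B := B)) := by
    intro i j
    by_cases hij : i = j
    · subst hij
      rw [M.diagonal, pow_one, auxRefl_sq]
    · rw [hM i j hij]
      have h1 := auxRefl_braid i j hij
      have h2 := auxRefl_sq (B := B) i
      have h3 := auxRefl_sq (B := B) j
      calc (auxRefl i * auxRefl j) ^ 3
          = (auxRefl i * auxRefl j * auxRefl i) * (auxRefl j * auxRefl i * auxRefl j) := by
            simp only [pow_succ, pow_zero, one_mul, mul_assoc]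
        _ = (auxRefl i * auxRefl j * auxRefl i) * (auxRefl i * auxRefl j * auxRefl i) := by rw [h1]
        _ = auxRefl i * (auxRefl j * (auxRefl i * auxRefl i) * auxRefl j) * auxRefl i := by
            simp only [mul_assoc]
        _ = 1 := by rw [h2, mul_one, h3, mul_one, h2]
  let ρ := cs.lift ⟨_, hl⟩
  have hρ : ∀ i, ρ (cs.simple i) = auxRefl i := fun i => cs.lift_apply_simple hl i
  refine ⟨fun w i => ρ w (Pi.single i 1), ?_, ?_, ?_, ?_⟩
  · intro w i
    simp only [map_mul, hρ, Module.End.mul_apply]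
    rw [← map_neg]
    congr 1
    ext k
    simp only [auxRefl_apply]
    by_cases hk : k = i
    · subst hk; simp
    · simp [hk]
  · intro w i j hij
    simp only [map_mul, hρ, Module.End.mul_apply]
    rw [← map_add]
    congr 1
    ext k
    simp only [auxRefl_apply]
    by_cases hk : k = i
    · subst hk; simp [hij]
    · simp [hk]
  · intro i k
    simp only [map_one, Module.End.one_apply]
    by_cases hk : k = i
    · subst hk; simp
    · simp [hk]
  · intro w i h0
    change ρ w (Pi.single i 1) = 0 at h0
    have : ρ (w⁻¹ * w) (Pi.single i 1) = 0 := by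
      rw [map_mul, Module.End.mul_apply, h0, map_zero]
    rw [inv_mul_cancel, map_one] at this
    have := congrFun this i
    simp at this

theorem simple_braid (cs : CoxeterSystem M W) (hM : ∀ i j, i ≠ j → M i j = 3) (i j : B)
    (hij : i ≠ j) : cs.simple i * cs.simple j * cs.simple i =
      cs.simple j * cs.simple i * cs.simple j := by
  have h := cs.simple_mul_simple_pow i j
  rw [hM i j hij] at h
  have h' : (cs.simple i * cs.simple j * cs.simple i) *
      (cs.simple j * cs.simple i * cs.simple j) = 1 := by
    rw [← h]; simp only [pow_succ, pow_zero, one_mul, mul_assoc]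
  rw [eq_comm, ← inv_inj, eq_comm, ← eq_inv_of_mul_eq_one_left h']
  simp [mul_assoc]

theorem pos_of_not_desc (cs : CoxeterSystem M W) (hM : ∀ i j, i ≠ j → M i j = 3)
    (rt : W → B → (B → ℤ)) (h1 : ∀ w i, rt (w * cs.simple i) i = - rt w i)
    (h2 : ∀ w i j, i ≠ j → rt (w * cs.simple i) j = rt w j + rt w i)
    (h3 : ∀ i, 0 ≤ rt 1 i) :
    ∀ k w i, cs.length w = k → ¬ cs.IsRightDescent w i → 0 ≤ rt w i := by
  intro k
  induction k using Nat.strong_induction_on with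
  | _ k ih =>
  intro w i hk hi
  by_cases hw : w = 1
  · subst hw; exact h3 i
  obtain ⟨j, hj⟩ := cs.exists_rightDescent_of_ne_one hw
  have hij : i ≠ j := by rintro rfl; exact hi hj
  have hj1 := (cs.isRightDescent_iff_not_isRightDescent_mul).1 hj
  have hl1 := cs.isRightDescent_iff.1 hj
  have ew : rt w i = rt (w * cs.simple j) i + rt (w * cs.simple j) j := by
    rw [← h2 _ _ _ hij.symm]; simp
  by_cases hc : cs.IsRightDescent (w * cs.simple j) i
  · have hl2 := cs.isRightDescent_iff.1 hc
    have e2 : rt w i = rt (w * cs.simple j * cs.simple i) j := by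
      rw [h2 _ _ _ hij, ew, add_comm]
    rw [e2]
    refine ih (cs.length (w * cs.simple j * cs.simple i)) (by omega) _ _ rfl ?_
    intro hd
    have hl3 := cs.isRightDescent_iff.1 hd
    have hl4 := cs.not_isRightDescent_iff.1 hi
    have e : w * cs.simple i =
        w * cs.simple j * cs.simple i * cs.simple j * cs.simple i * cs.simple j := by
      have := simple_braid cs hM i j hij
      calc w * cs.simple i = w * cs.simple j * cs.simple i * (cs.simple i * cs.simple j * cs.simple i) := by
            simp [mul_assoc]
        _ = _ := by rw [this]; simp only [mul_assoc]
    have l1 := cs.length_mul_le (w * cs.simple j * cs.simple i * cs.simple j * cs.simple i) (cs.simple j)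
    have l2 := cs.length_mul_le (w * cs.simple j * cs.simple i * cs.simple j) (cs.simple i)
    rw [← e] at l1
    simp only [cs.length_simple] at l1 l2
    omega
  · rw [ew]
    exact add_nonneg (ih _ (by omega) _ _ rfl hc) (ih _ (by omega) _ _ rfl hj1)

theorem desc_facts (cs : CoxeterSystem M W) (hM : ∀ i j, i ≠ j → M i j = 3) :
    (∀ w i j, i ≠ j → ¬ cs.IsRightDescent w i → ¬ cs.IsRightDescent w j →
      ¬ cs.IsRightDescent (w * cs.simple i) j) ∧
    (∀ w i j, i ≠ j → (cs.IsRightDescent (w * cs.simple i * cs.simple j) i ↔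
      cs.IsRightDescent w j)) ∧
    (∀ w i j k, i ≠ j → i ≠ k → j ≠ k → cs.IsRightDescent w i → cs.IsRightDescent w j →
      cs.IsRightDescent w k → False) := by
  obtain ⟨rt, h1, h2, h3, h4⟩ := exists_rt cs hM
  have hp := fun w i => pos_of_not_desc cs hM rt h1 h2 h3 _ w i rfl
  have hn : ∀ w i, cs.IsRightDescent w i → rt w i ≤ 0 := by
    intro w i hd
    have := hp _ _ ((cs.isRightDescent_iff_not_isRightDescent_mul).1 hd)
    rw [h1] at this
    exact neg_nonneg.1 this
  have hiff : ∀ w i, cs.IsRightDescent w i ↔ ¬ 0 ≤ rt w i := by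
    intro w i
    constructor
    · intro hd h0
      exact h4 w i (le_antisymm (hn w i hd) h0)
    · intro h; by_contra hc; exact h (hp w i hc)
  refine ⟨?_, ?_, ?_⟩
  · intro w i j hij hi hj
    rw [hiff, h2 _ _ _ hij, not_not]
    exact add_nonneg (hp _ _ hj) (hp _ _ hi)
  · intro w i j hij
    rw [hiff, hiff, h2 _ _ _ hij.symm, h1, h2 _ _ _ hij]
    simp
  · have key : ∀ m w i j k, cs.length w = m → i ≠ j → i ≠ k → j ≠ k →
        0 ≤ rt w i + rt w j + rt w k := by
      intro m
      induction m using Nat.strong_induction_on with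
      | _ m ih =>
      have step : ∀ w i j k, cs.length w = m → i ≠ j → i ≠ k → j ≠ k → cs.IsRightDescent w i →
          0 ≤ rt w i + rt w j + rt w k := by
        intro w i j k hm hij hik hjk hd
        have hl := cs.isRightDescent_iff.1 hd
        have := ih _ (by omega) (w * cs.simple i) i j k rfl hij hik hjk
        rw [h1, h2 _ _ _ hij, h2 _ _ _ hik] at this
        convert this using 1
        abel
      intro w i j k hm hij hik hjk
      by_cases hi : cs.IsRightDescent w i
      · exact step w i j k hm hij hik hjk hi
      by_cases hj : cs.IsRightDescent w j
      · have := step w j i k hm hij.symm hjk hik hj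
        convert this using 1; abel
      by_cases hk : cs.IsRightDescent w k
      · have := step w k i j hm hik.symm hjk.symm hij hk
        convert this using 1; abel
      exact add_nonneg (add_nonneg (hp _ _ hi) (hp _ _ hj)) (hp _ _ hk)
    intro w i j k hij hik hjk hi hj hk
    have a := key _ w i j k rfl hij hik hjk
    refine h4 w i (le_antisymm (hn _ _ hi) ?_)
    refine a.trans ?_
    rw [add_assoc]
    exact add_le_of_nonpos_right (add_nonpos (hn _ _ hj) (hn _ _ hk))

theorem finite_len (cs : CoxeterSystem M W) (k : ℕ) : {w : W | cs.length w = k}.Finite := by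
  refine (Set.Finite.image cs.wordProd (List.finite_length_eq B k)).subset ?_
  intro w hw
  obtain ⟨ω, h, rfl⟩ := cs.exists_isReduced w
  exact ⟨ω, by rw [Set.mem_ofPred_eq, ← h.eq]; exact hw, rfl⟩

/-- weighted length series -/
noncomputable def gs (cs : CoxeterSystem M W) (f : W → ℤ) : PowerSeries ℤ :=
  PowerSeries.mk fun k => ∑ w ∈ (finite_len cs k).toFinset, f w

theorem gs_add (cs : CoxeterSystem M W) (f g : W → ℤ) :
    gs cs (fun w => f w + g w) = gs cs f + gs cs g := by
  ext k; simp [gs, Finset.sum_add_distrib]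

theorem gs_sub (cs : CoxeterSystem M W) (f g : W → ℤ) :
    gs cs (fun w => f w - g w) = gs cs f - gs cs g := by
  ext k; simp [gs, Finset.sum_sub_distrib]

theorem gs_two_mul (cs : CoxeterSystem M W) (f : W → ℤ) :
    gs cs (fun w => 2 * f w) = 2 * gs cs f := by
  simp only [two_mul, gs_add]

theorem gs_sum (cs : CoxeterSystem M W) {ι : Type*} (s : Finset ι) (f : ι → W → ℤ) :
    gs cs (fun w => ∑ a ∈ s, f a w) = ∑ a ∈ s, gs cs (f a) := by
  ext k
  simp only [gs, map_sum, coeff_mk]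
  rw [Finset.sum_comm]

theorem gs_shift (cs : CoxeterSystem M W) (p q : W → Prop) [DecidablePred p] [DecidablePred q] (g : W) (m : ℕ)
    (hq : ∀ u, q u → p (u * g) ∧ cs.length (u * g) = cs.length u + m)
    (hp : ∀ w, p w → q (w * g⁻¹)) :
    gs cs (fun w => if p w then 1 else 0) = X ^ m * gs cs (fun w => if q w then 1 else 0) := by
  have hp' : ∀ w, p w → cs.length w = cs.length (w * g⁻¹) + m := by
    intro w hw
    have := (hq _ (hp w hw)).2
    simpa using this
  ext k
  rw [coeff_X_pow_mul']
  simp only [gs, coeff_mk]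
  split_ifs with hk
  · rw [← Finset.sum_filter, ← Finset.sum_filter]
    refine Finset.sum_bij' (fun w _ => w * g⁻¹) (fun u _ => u * g) ?_ ?_ ?_ ?_ ?_
    · intro w hw
      simp only [Finset.mem_filter, Set.Finite.mem_toFinset, Set.mem_ofPred_eq] at hw ⊢
      exact ⟨by have := hp' w hw.2; omega, hp w hw.2⟩
    · intro w hw
      simp only [Finset.mem_filter, Set.Finite.mem_toFinset, Set.mem_ofPred_eq] at hw ⊢
      exact ⟨by have := (hq w hw.2).2; omega, (hq w hw.2).1⟩
    · intro w _; simp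
    · intro w _; simp
    · intro w _; rfl
  · refine Finset.sum_eq_zero ?_
    intro w hw
    simp only [Set.Finite.mem_toFinset, Set.mem_ofPred_eq] at hw
    rw [if_neg]
    intro h
    have := hp' w h
    omega

open Classical in
theorem gs_main (cs : CoxeterSystem M W) (hM : ∀ i j, i ≠ j → M i j = 3) :
    (2 * ((1 + X) * (1 + X + X ^ 2)) : PowerSeries ℤ) =
      (2 * ((1 + X) * (1 + X + X ^ 2)) - 2 * (Fintype.card B : PowerSeries ℤ) * X * (1 + X + X ^ 2)
        + ((Fintype.card B * Fintype.card B - Fintype.card B : ℕ) : PowerSeries ℤ) * X ^ 3) *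
        gs cs (fun _ => 1) := by
  obtain ⟨fb, fc, ft⟩ := desc_facts cs hM
  have fa : ∀ w i, cs.IsRightDescent (w * cs.simple i) i ↔ ¬ cs.IsRightDescent w i := by
    intro w i
    have := cs.isRightDescent_iff_not_isRightDescent_mul (w := w) (i := i)
    tauto
  have fl : ∀ w i, ¬ cs.IsRightDescent w i → cs.length (w * cs.simple i) = cs.length w + 1 :=
    fun w i => cs.not_isRightDescent_iff.1
  -- single descents
  have hD : ∀ i, gs cs (fun w => if cs.IsRightDescent w i then 1 else 0) =
      X ^ 1 * gs cs (fun w => if ¬ cs.IsRightDescent w i then 1 else 0) := by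
    intro i
    refine gs_shift cs (fun w => cs.IsRightDescent w i) (fun w => ¬ cs.IsRightDescent w i)
      (cs.simple i) 1 ?_ ?_
    · intro u hu
      exact ⟨(fa u i).2 hu, fl u i hu⟩
    · intro w hw
      rw [cs.inv_simple, fa]
      exact not_not.2 hw
  have hP : ∀ i, gs cs (fun _ => 1) =
      (1 + X) * gs cs (fun w => if ¬ cs.IsRightDescent w i then 1 else 0) := by
    intro i
    have hDi := hD i
    rw [pow_one] at hDi
    rw [add_mul, one_mul, ← hDi, ← gs_add]
    congr 1
    ext w
    by_cases h : cs.IsRightDescent w i <;> simp [h]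
  have hE : ∀ i j, i ≠ j → gs cs (fun w => if ¬ cs.IsRightDescent w i then 1 else 0) =
      (1 + X + X ^ 2) * gs cs (fun w => if ¬ cs.IsRightDescent w i ∧ ¬ cs.IsRightDescent w j
        then 1 else 0) := by
    intro i j hij
    have e1 := gs_shift cs (fun w => ¬ cs.IsRightDescent (w * cs.simple j) i ∧
      ¬ cs.IsRightDescent (w * cs.simple j) j)
      (fun w => ¬ cs.IsRightDescent w i ∧ ¬ cs.IsRightDescent w j) (cs.simple j) 1
      (by
        intro u hu
        refine ⟨by simpa using hu, fl _ _ hu.2⟩) (by intro w hw; simpa using hw)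
    have e2 := gs_shift cs (fun w => ¬ cs.IsRightDescent (w * cs.simple j * cs.simple i) i ∧
      ¬ cs.IsRightDescent (w * cs.simple j * cs.simple i) j)
      (fun w => ¬ cs.IsRightDescent w i ∧ ¬ cs.IsRightDescent w j) (cs.simple i * cs.simple j) 2
      (by
        intro u hu
        refine ⟨by simpa [← mul_assoc] using hu, ?_⟩
        rw [← mul_assoc, fl _ _ (fb u i j hij hu.1 hu.2), fl _ _ hu.1])
      (by intro w hw; simpa [← mul_assoc] using hw)
    rw [add_mul, add_mul, one_mul]
    rw [pow_one] at e1
    rw [← e1, ← e2, ← gs_add, ← gs_add]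
    congr 1
    ext w
    have a1 := fa w j
    have a2 := fa (w * cs.simple j) i
    have b1 := fb w j i hij.symm
    have b2 := fb (w * cs.simple j) j i hij.symm
    rw [cs.simple_mul_simple_cancel_right] at b2
    have c1 := fc w j i hij.symm
    by_cases h1 : cs.IsRightDescent w i <;> by_cases h2 : cs.IsRightDescent w j <;>
      by_cases h3 : cs.IsRightDescent (w * cs.simple j) i <;>
      simp only [h1, h2, h3, not_true, not_false_iff, true_iff, iff_true, false_iff, iff_false,
        true_imp_iff, imp_false] at a1 a2 b1 b2 c1 <;>
      simp_all
  have hDD : ∀ i j, i ≠ j → gs cs (fun w => if cs.IsRightDescent w i ∧ cs.IsRightDescent w j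
        then 1 else 0) = X ^ 3 * gs cs (fun w => if ¬ cs.IsRightDescent w i ∧
          ¬ cs.IsRightDescent w j then 1 else 0) := by
    intro i j hij
    refine gs_shift cs (fun w => cs.IsRightDescent w i ∧ cs.IsRightDescent w j)
      (fun w => ¬ cs.IsRightDescent w i ∧ ¬ cs.IsRightDescent w j)
      (cs.simple i * cs.simple j * cs.simple i) 3 ?_ ?_
    · intro u hu
      have x2 := fb u i j hij hu.1 hu.2
      have x3 := mt (fc u i j hij).1 hu.2
      refine ⟨⟨?_, ?_⟩, ?_⟩
      · rw [← mul_assoc, ← mul_assoc, fa]; exact x3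
      · rw [← mul_assoc, ← mul_assoc, fc _ j i hij.symm, fa]; exact hu.1
      · rw [← mul_assoc, ← mul_assoc, fl _ _ x3, fl _ _ x2, fl _ _ hu.1]
    · intro w hw
      simp only [mul_inv_rev, cs.inv_simple, ← mul_assoc]
      rw [fa, fc _ i j hij, fc _ j i hij.symm, fa]
      exact ⟨not_not.2 hw.2, not_not.2 hw.1⟩
  have hone : gs cs (fun w => if w = 1 then 1 else 0) = 1 := by
    ext k
    simp only [gs, coeff_mk, coeff_one, Finset.sum_ite_eq', Set.Finite.mem_toFinset,
      Set.mem_ofPred_eq, cs.length_one, eq_comm]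
  have hpt : (fun w => 2 * (if w = 1 then 1 else 0 : ℤ)) = fun w =>
      2 * (fun _ => (1 : ℤ)) w - 2 * (∑ i, if cs.IsRightDescent w i then 1 else 0) +
      ∑ a ∈ (Finset.univ : Finset B).offDiag,
        if cs.IsRightDescent w a.1 ∧ cs.IsRightDescent w a.2 then 1 else 0 := by
    ext w
    set D := (Finset.univ : Finset B).filter (fun i => cs.IsRightDescent w i) with hDdef
    have s1 : (∑ i, if cs.IsRightDescent w i then (1 : ℤ) else 0) = D.card := by
      simp [hDdef]
    have s2 : (∑ a ∈ (Finset.univ : Finset B).offDiag,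
        if cs.IsRightDescent w a.1 ∧ cs.IsRightDescent w a.2 then (1 : ℤ) else 0) =
        D.offDiag.card := by
      rw [Finset.sum_boole]
      congr 2
      ext a
      simp [hDdef]
      tauto
    rw [s1, s2, Finset.offDiag_card]
    have hle : D.card ≤ 2 := by
      by_contra hc
      obtain ⟨i, j, k, hi, hj, hk, hij, hik, hjk⟩ := Finset.two_lt_card_iff.1 (not_le.1 hc)
      simp only [hDdef, Finset.mem_filter, Finset.mem_univ, true_and] at hi hj hk
      exact ft w i j k hij hik hjk hi hj hk
    have h0 : D.card = 0 ↔ w = 1 := by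
      rw [Finset.card_eq_zero]
      constructor
      · intro h
        by_contra hw
        obtain ⟨i, hi⟩ := cs.exists_rightDescent_of_ne_one hw
        have : i ∈ D := by simp [hDdef, hi]
        rw [h] at this
        simp at this
      · rintro rfl
        simp [hDdef, cs.not_isRightDescent_one]
    rw [← h0]
    generalize D.card = d at *
    interval_cases d <;> simp
  have hS := congrArg (gs cs) hpt
  rw [gs_add, gs_sub, gs_two_mul, gs_two_mul, gs_two_mul, gs_sum, gs_sum, hone] at hS
  set P := gs cs (fun _ => 1) with hPdef
  have q1 : ((1 + X) * (1 + X + X ^ 2) : PowerSeries ℤ) *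
      ∑ i, gs cs (fun w => if cs.IsRightDescent w i then 1 else 0) =
      (Fintype.card B : PowerSeries ℤ) * (X * (1 + X + X ^ 2) * P) := by
    rw [Finset.mul_sum, Finset.sum_congr rfl (g := fun _ => X * (1 + X + X ^ 2) * P)]
    · simp
    · intro i _
      rw [hD i, hP i]; ring
  have q2 : ((1 + X) * (1 + X + X ^ 2) : PowerSeries ℤ) *
      ∑ a ∈ (Finset.univ : Finset B).offDiag,
        gs cs (fun w => if cs.IsRightDescent w a.1 ∧ cs.IsRightDescent w a.2 then 1 else 0) =
      ((Fintype.card B * Fintype.card B - Fintype.card B : ℕ) : PowerSeries ℤ) * (X ^ 3 * P) := by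
    rw [Finset.mul_sum, Finset.sum_congr rfl (g := fun _ => X ^ 3 * P)]
    · rw [Finset.sum_const, Finset.offDiag_card, Finset.card_univ, nsmul_eq_mul]
    · intro a ha
      have hne : a.1 ≠ a.2 := by simpa using ha
      rw [hDD _ _ hne, hP a.1, hE _ _ hne]; ring
  linear_combination ((1 + X) * (1 + X + X ^ 2) : PowerSeries ℤ) * hS - 2 * q1 + q2

end Aux

/-- for an `n × n` generalized Cartan matrix (`n ≥ 2`) with
`aᵢⱼ·aⱼᵢ = 1` for all `i ≠ j`,
`(((n−1)(n−2)/2)·t³ − (n−2)·t² − (n−2)·t + 1)·P(A) = (1+t)(1+t+t²)`. -/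
theorem poincare_all_products_one {n : ℕ} (hn : 2 ≤ n)
    (A : Matrix (Fin n) (Fin n) ℤ) (hA : IsGCM A)
    (h : ∀ i j, i ≠ j → A i j * A j i = 1) :
    ((((n - 1) * (n - 2) / 2 : ℕ) : PowerSeries ℤ) * X ^ 3
        - ((n - 2 : ℕ) : PowerSeries ℤ) * X ^ 2
        - ((n - 2 : ℕ) : PowerSeries ℤ) * X + 1) * coxPoincare (gcmCoxeter A)
      = (1 + X) * (1 + X + X ^ 2) := by
  have hM : ∀ i j, i ≠ j → gcmCoxeter A i j = 3 := by
    intro i j hij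
    change (if i = j then 1 else gcmEntry (A i j * A j i)) = 3
    rw [if_neg hij, h i j hij]
    rfl
  have hmain := gs_main (gcmCoxeter A).toCoxeterSystem hM
  have hP : coxPoincare (gcmCoxeter A) = gs (gcmCoxeter A).toCoxeterSystem (fun _ => 1) := by
    ext k
    simp only [coxPoincare, gs, coeff_mk]
    rw [Finset.sum_const, nsmul_eq_mul, mul_one,
      ← Set.ncard_eq_toFinset_card _ (finite_len (gcmCoxeter A).toCoxeterSystem k)]
    rfl
  rw [hP]
  set P := gs (gcmCoxeter A).toCoxeterSystem (fun _ => 1)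
  have h2 : (2 : PowerSeries ℤ) ≠ 0 := by
    intro h0
    have := congrArg (constantCoeff (R := ℤ)) h0
    rw [map_ofNat, map_zero] at this
    exact absurd this (by norm_num)
  apply mul_left_cancel₀ h2
  rw [hmain, Fintype.card_fin]
  obtain ⟨m, rfl⟩ := Nat.exists_eq_add_of_le hn
  have e1 : ((((2 + m - 1) * (2 + m - 2) / 2 : ℕ) : PowerSeries ℤ)) * 2 = (m + 1) * m := by
    have : (2 + m - 1) * (2 + m - 2) / 2 * 2 = (m + 1) * m := by
      rw [show 2 + m - 1 = m + 1 by omega, show 2 + m - 2 = m by omega]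
      exact Nat.div_mul_cancel (by rw [mul_comm]; exact (Nat.even_mul_succ_self m).two_dvd)
    have := congrArg (Nat.cast : ℕ → PowerSeries ℤ) this
    rw [Nat.cast_mul, Nat.cast_mul, Nat.cast_ofNat, Nat.cast_add, Nat.cast_one] at this
    exact this
  have e2 : (((2 + m) * (2 + m) - (2 + m) : ℕ) : PowerSeries ℤ) = (m + 2) * (m + 1) := by
    have : (2 + m) * (2 + m) - (2 + m) = (m + 2) * (m + 1) := by
      apply Nat.sub_eq_of_eq_add; ring
    rw [this]; push_cast; rfl
  have e3 : ((2 + m - 2 : ℕ) : PowerSeries ℤ) = m := by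
    rw [show 2 + m - 2 = m by omega]
  rw [e2, e3]
  push_cast
  linear_combination (X ^ 3 * P) * e1
end

section
/- Let A=(a_{ij}) be an n×n generalized Cartan matrix with n ≥ 2 such that a_{ij}a_{ji}=3 for all i≠j (equivalently, every off-diagonal Coxeter matrix entry equals 6). Then in ℤ⟦t⟧: ( ((n−1)(n−2)/2)·t⁶ − (n−2)·(t⁵+t⁴+t³+t²+t) + 1 ) · P(A) = (1+t)(1+t+t²+t³+t⁴+t⁵). -/
open PowerSeries

section helpers
variable {n : ℕ} {A : Matrix (Fin n) (Fin n) ℤ}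

/-- simple reflection -/
noncomputable def pf (A : Matrix (Fin n) (Fin n) ℤ) (i : Fin n) :
    Module.End ℤ (Fin n → ℤ) :=
  LinearMap.id - ((LinearMap.proj i).comp (Matrix.mulVecLin A)).smulRight (Pi.single i 1)

lemma pf_apply (i : Fin n) (v) : pf A i v = v - (A.mulVec v i) • Pi.single i 1 := by
  simp [pf]

lemma pf_single (i j : Fin n) :
    pf A i (Pi.single j 1) = Pi.single j 1 - A i j • Pi.single i 1 := by
  simp [pf_apply]

lemma mulVec_aux (v : Fin n → ℤ) (i j : Fin n) (p : ℤ) :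
    A.mulVec (v - p • Pi.single j 1) i = A.mulVec v i - p * A i j := by
  rw [Matrix.mulVec_sub, Matrix.mulVec_smul]
  simp [-zsmul_eq_mul]

lemma gcm_entry (h : ∀ i j, i ≠ j → A i j * A j i = 3) (i j : Fin n) :
    (gcmCoxeter A) i j = if i = j then 1 else 6 := by
  change (if i = j then 1 else gcmEntry (A i j * A j i)) = _
  split_ifs with hij
  · rfl
  · rw [h i j hij]; rfl

lemma pf_liftable (hA : IsGCM A) (h : ∀ i j, i ≠ j → A i j * A j i = 3) :
    (gcmCoxeter A).IsLiftable (pf A) := by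
  intro i j
  rw [gcm_entry h]
  split_ifs with hij
  · subst hij
    refine LinearMap.ext fun v => ?_
    simp only [pow_one, Module.End.mul_apply, Module.End.one_apply, pf_apply, mulVec_aux, hA.diag]
    module
  · have h3 := h i j hij
    set g := pf A i * pf A j with hg
    have key : g ^ 3 = 2 • g ^ 2 - 2 • g + 1 := by
      refine LinearMap.ext fun v => ?_
      simp only [hg, pow_succ, pow_zero, one_mul, Module.End.mul_apply, Module.End.one_apply,
        LinearMap.add_apply, LinearMap.sub_apply, LinearMap.smul_apply,
        pf_apply, mulVec_aux, hA.diag]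
      generalize A.mulVec v i = x
      generalize A.mulVec v j = y
      generalize A i j = a at *
      generalize A j i = b at *
      funext k
      simp only [Pi.sub_apply, Pi.add_apply, Pi.smul_apply, smul_eq_mul]
      generalize (Pi.single i 1 : Fin n → ℤ) k = e
      generalize (Pi.single j 1 : Fin n → ℤ) k = f
      have : b * a = 3 := by rw [mul_comm]; exact h3
      grind
    have k6 : g ^ 6 = 1 + (g ^ 3 + 2 • g ^ 2 + 2 • g + 1) * (g ^ 3 - (2 • g ^ 2 - 2 • g + 1)) := by
      noncomm_ring
    rw [k6, key, sub_self, mul_zero, add_zero]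

/-- the root `w α_i` -/
noncomputable def rt (hA : IsGCM A) (h : ∀ i j, i ≠ j → A i j * A j i = 3)
    (w : (gcmCoxeter A).Group) (i : Fin n) : Fin n → ℤ :=
  (gcmCoxeter A).toCoxeterSystem.lift ⟨pf A, pf_liftable hA h⟩ w (Pi.single i 1)

variable (hA : IsGCM A) (h : ∀ i j, i ≠ j → A i j * A j i = 3)

local notation "cs" => CoxeterMatrix.toCoxeterSystem (gcmCoxeter A)
local notation "sg" => CoxeterSystem.simple (CoxeterMatrix.toCoxeterSystem (gcmCoxeter A))
local notation "len" => CoxeterSystem.length (CoxeterMatrix.toCoxeterSystem (gcmCoxeter A))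

lemma rt_one (i : Fin n) : rt hA h 1 i = Pi.single i 1 := by
  simp [rt]

lemma rt_mul (w : (gcmCoxeter A).Group) (i j : Fin n) :
    rt hA h (w * sg i) j = rt hA h w j - A i j • rt hA h w i := by
  unfold rt
  rw [map_mul, Module.End.mul_apply, CoxeterSystem.lift_apply_simple, pf_single, map_sub, map_smul]

lemma rt_ne (w : (gcmCoxeter A).Group) (i : Fin n) : rt hA h w i ≠ 0 := by
  intro h0
  have := congrArg ((gcmCoxeter A).toCoxeterSystem.lift ⟨pf A, pf_liftable hA h⟩ w⁻¹) h0
  unfold rt at this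
  rw [← Module.End.mul_apply, ← map_mul, inv_mul_cancel, map_one, map_zero] at this
  have := congrFun this i
  simp at this

include hA in
lemma neg_entry {i j : Fin n} (hij : i ≠ j) : 0 ≤ - A i j := by
  have := hA.nonpos i j hij; omega

include h in
lemma braid {i j : Fin n} (hij : i ≠ j) (w : (gcmCoxeter A).Group) :
    w * sg i * sg j * sg i * sg j * sg i * sg j = w * sg j * sg i * sg j * sg i * sg j * sg i := by
  have := (cs).simple_mul_simple_pow i j
  rw [gcm_entry h, if_neg hij] at this
  have e : (sg i * sg j) ^ 3 = (sg j * sg i) ^ 3 := by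
    have e1 : (sg i * sg j) ^ 3 * (sg i * sg j) ^ 3 = 1 := by rw [← pow_add]; exact this
    have e2 : ((sg i * sg j) ^ 3)⁻¹ = (sg j * sg i) ^ 3 := by
      rw [← inv_pow, mul_inv_rev, (cs).inv_simple, (cs).inv_simple]
    rw [← e2]; exact eq_inv_of_mul_eq_one_left e1
  have := congrArg (w * ·) e
  simpa [pow_succ, mul_assoc] using this

lemma combo {p q : Fin n → ℤ} {a b : ℤ} (hp : 0 ≤ p) (hq : 0 ≤ q) (ha : 0 ≤ a) (hb : 0 ≤ b) :
    0 ≤ a • p + b • q := add_nonneg (smul_nonneg ha hp) (smul_nonneg hb hq)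

theorem tits (N : ℕ) : ∀ (w : (gcmCoxeter A).Group), len w = N → ∀ s : Fin n,
    ¬ (cs).IsRightDescent w s → 0 ≤ rt hA h w s := by
  induction N using Nat.strong_induction_on with
  | _ N ih =>
  intro w hw s hs
  by_cases h1 : w = 1
  · subst h1; rw [rt_one]; intro k; simp [Pi.single_apply]; split_ifs <;> simp
  obtain ⟨t, ht⟩ := (cs).exists_rightDescent_of_ne_one h1
  have hst : s ≠ t := by rintro rfl; exact hs ht
  have hc := neg_entry hA hst.symm
  have h33 := h s t hst
  have h34 := h t s hst.symm
  have ds := hA.diag s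
  have dt := hA.diag t
  have IH : ∀ u, len u < len w → ¬ (cs).IsRightDescent u s → ¬ (cs).IsRightDescent u t →
      0 ≤ rt hA h u s ∧ 0 ≤ rt hA h u t := fun u hu a b =>
    ⟨ih _ (hw ▸ hu) u rfl s a, ih _ (hw ▸ hu) u rfl t b⟩
  have fin : ∀ (u v : (gcmCoxeter A).Group) (i : Fin n), u * sg i = v → v * sg i = u := by
    rintro u v i rfl
    simp only [CoxeterSystem.simple_mul_simple_cancel_right]
  have up : ∀ (v : (gcmCoxeter A).Group) (i : Fin n), (cs).IsRightDescent v i →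
      len (v * sg i) + 1 = len v ∧ ¬ (cs).IsRightDescent (v * sg i) i := by
    intro v i hv
    exact ⟨(cs).isRightDescent_iff.1 hv, (cs).isRightDescent_iff_not_isRightDescent_mul.1 hv⟩
  obtain ⟨l1, n1⟩ := up w t ht
  generalize e1 : w * sg t = u1 at *
  have e1 := fin _ _ _ e1
  by_cases d1 : ¬ (cs).IsRightDescent u1 s
  · obtain ⟨p, q⟩ := IH u1 (by omega) d1 n1
    rw [← e1]
    convert combo p q zero_le_one hc using 1
    simp only [rt_mul]
    module
  rw [not_not] at d1
  obtain ⟨l2, n2⟩ := up _ _ d1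
  generalize e2 : u1 * sg s = u2 at *
  have e2 := fin _ _ _ e2
  by_cases d2 : ¬ (cs).IsRightDescent u2 t
  · obtain ⟨p, q⟩ := IH u2 (by omega) n2 d2
    rw [← e1, ← e2]
    convert combo p q zero_le_two hc using 1
    simp only [rt_mul]
    funext k; simp only [Pi.sub_apply, Pi.add_apply, Pi.smul_apply, smul_eq_mul]; grind
  rw [not_not] at d2
  obtain ⟨l3, n3⟩ := up _ _ d2
  generalize e3 : u2 * sg t = u3 at *
  have e3 := fin _ _ _ e3
  by_cases d3 : ¬ (cs).IsRightDescent u3 s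
  · obtain ⟨p, q⟩ := IH u3 (by omega) d3 n3
    rw [← e1, ← e2, ← e3]
    convert combo p q zero_le_two hc using 1
    simp only [rt_mul]
    funext k; simp only [Pi.sub_apply, Pi.add_apply, Pi.smul_apply, smul_eq_mul]; grind
  rw [not_not] at d3
  obtain ⟨l4, n4⟩ := up _ _ d3
  generalize e4 : u3 * sg s = u4 at *
  have e4 := fin _ _ _ e4
  by_cases d4 : ¬ (cs).IsRightDescent u4 t
  · obtain ⟨p, q⟩ := IH u4 (by omega) n4 d4
    rw [← e1, ← e2, ← e3, ← e4]
    convert combo p q zero_le_one hc using 1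
    simp only [rt_mul]
    funext k; simp only [Pi.sub_apply, Pi.add_apply, Pi.smul_apply, smul_eq_mul]; grind
  rw [not_not] at d4
  obtain ⟨l5, n5⟩ := up _ _ d4
  generalize e5 : u4 * sg t = u5 at *
  have e5 := fin _ _ _ e5
  by_cases d5 : ¬ (cs).IsRightDescent u5 s
  · obtain ⟨p, q⟩ := IH u5 (by omega) d5 n5
    rw [← e1, ← e2, ← e3, ← e4, ← e5]
    convert p using 1
    simp only [rt_mul]
    funext k; simp only [Pi.sub_apply, Pi.smul_apply, smul_eq_mul]; grind
  rw [not_not] at d5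
  obtain ⟨l6, n6⟩ := up _ _ d5
  generalize e6 : u5 * sg s = u6 at *
  have e6 := fin _ _ _ e6
  exfalso
  apply hs
  have hb : w * sg s = u6 * sg t * sg s * sg t * sg s * sg t := by
    rw [← e1, ← e2, ← e3, ← e4, ← e5, ← e6, braid h hst]
    simp only [CoxeterSystem.simple_mul_simple_cancel_right]
  have g : ∀ v i, len (v * sg i) ≤ len v + 1 := by
    intro v i
    have := (cs).length_mul_le v (sg i)
    rwa [(cs).length_simple] at this
  unfold CoxeterSystem.IsRightDescent
  rw [hb]
  have g1 := g u6 t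
  have g2 := g (u6 * sg t) s
  have g3 := g (u6 * sg t * sg s) t
  have g4 := g (u6 * sg t * sg s * sg t) s
  have g5 := g (u6 * sg t * sg s * sg t * sg s) t
  omega

lemma rt_nonneg {w : (gcmCoxeter A).Group} {s : Fin n} (hs : ¬ (cs).IsRightDescent w s) :
    0 ≤ rt hA h w s := tits hA h _ w rfl s hs

lemma rt_nonpos {w : (gcmCoxeter A).Group} {s : Fin n} (hs : (cs).IsRightDescent w s) :
    rt hA h w s ≤ 0 := by
  have := rt_nonneg hA h ((cs).isRightDescent_iff_not_isRightDescent_mul.1 hs)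
  rw [rt_mul, hA.diag] at this
  have e : rt hA h w s - (2:ℤ) • rt hA h w s = - rt hA h w s := by module
  rw [e] at this
  exact neg_nonneg.1 this

lemma desc_iff {w : (gcmCoxeter A).Group} {s : Fin n} :
    (cs).IsRightDescent w s ↔ rt hA h w s ≤ 0 := by
  refine ⟨rt_nonpos hA h, fun hs => ?_⟩
  by_contra hc
  exact rt_ne hA h w s (le_antisymm hs (rt_nonneg hA h hc))

lemma no_three_aux (N : ℕ) : ∀ (w : (gcmCoxeter A).Group), len w = N → ∀ a b c : Fin n,
    a ≠ b → a ≠ c → b ≠ c → rt hA h w a ≤ 0 → rt hA h w b ≤ 0 →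
    rt hA h w c - A a c • rt hA h w a ≤ 0 → False := by
  induction N using Nat.strong_induction_on with
  | _ N ih =>
  intro w hw a b c hab hac hbc ha hb hc
  have hd := (desc_iff hA h).2 ha
  refine ih _ (hw ▸ hd) (w * sg a) rfl b c a hbc hab.symm hac.symm ?_ ?_ ?_
  · rw [rt_mul]
    have := neg_entry hA hab
    intro k
    have := ha k; have := hb k
    simp only [Pi.sub_apply, Pi.smul_apply, smul_eq_mul, Pi.zero_apply] at *
    nlinarith
  · rwa [rt_mul]
  · rw [rt_mul, rt_mul, hA.diag]
    have h3 := h b a hab.symm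
    have := neg_entry hA hab.symm
    intro k
    have := ha k; have := hb k
    simp only [Pi.sub_apply, Pi.smul_apply, smul_eq_mul, Pi.zero_apply] at *
    have e : rt hA h w a k - 2 * rt hA h w a k - A b a * (rt hA h w b k - A a b * rt hA h w a k)
      = 2 * rt hA h w a k + (- A b a) * rt hA h w b k := by grind
    rw [e]; nlinarith

include hA h in
lemma no_three (w : (gcmCoxeter A).Group) (a b c : Fin n) (hab : a ≠ b) (hac : a ≠ c) (hbc : b ≠ c)
    (ha : (cs).IsRightDescent w a) (hb : (cs).IsRightDescent w b) (hc : (cs).IsRightDescent w c) :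
    False := by
  rw [desc_iff hA h] at ha hb hc
  refine no_three_aux hA h _ w rfl a b c hab hac hbc ha hb ?_
  have := neg_entry hA hac
  intro k
  have := ha k; have := hc k
  simp only [Pi.sub_apply, Pi.smul_apply, smul_eq_mul, Pi.zero_apply] at *
  nlinarith

/-- multiplication by the longest element of the dihedral group -/
noncomputable def mw (i j : Fin n) (w : (gcmCoxeter A).Group) : (gcmCoxeter A).Group :=
  w * sg i * sg j * sg i * sg j * sg i * sg j

include h in
lemma mw_mw {i j : Fin n} (hij : i ≠ j) (w : (gcmCoxeter A).Group) : mw i j (mw i j w) = w := by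
  unfold mw
  rw [braid h hij (w * sg i * sg j * sg i * sg j * sg i * sg j)]
  simp only [CoxeterSystem.simple_mul_simple_cancel_right]

lemma rt_mw {i j : Fin n} (hij : i ≠ j) (w : (gcmCoxeter A).Group) :
    rt hA h (mw i j w) i = - rt hA h w i ∧ rt hA h (mw i j w) j = - rt hA h w j := by
  have h33 := h i j hij
  have ds := hA.diag i
  have dt := hA.diag j
  unfold mw
  simp only [rt_mul]
  constructor <;>
  · funext k; simp only [Pi.sub_apply, Pi.smul_apply, smul_eq_mul, Pi.neg_apply]; grind

include hA h in
lemma mw_down {i j : Fin n} (hij : i ≠ j) {w : (gcmCoxeter A).Group}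
    (hi : (cs).IsRightDescent w i) (hj : (cs).IsRightDescent w j) :
    len (mw i j w) + 6 = len w ∧ ¬ (cs).IsRightDescent (mw i j w) i ∧
      ¬ (cs).IsRightDescent (mw i j w) j := by
  have h33 := h i j hij
  have ds := hA.diag i
  have dt := hA.diag j
  have ci := neg_entry hA hij
  have cj := neg_entry hA hij.symm
  have key : ∀ (v : (gcmCoxeter A).Group) (s : Fin n) (a b : ℤ), 0 ≤ a → 0 ≤ b →
      rt hA h v s = a • rt hA h w i + b • rt hA h w j → len (v * sg s) + 1 = len v := by
    intro v s a b ha hb e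
    rw [← (cs).isRightDescent_iff, desc_iff hA h, e]
    have := combo (neg_nonneg.2 ((desc_iff hA h).1 hi)) (neg_nonneg.2 ((desc_iff hA h).1 hj)) ha hb
    rw [← neg_nonneg]
    convert this using 1; module
  refine ⟨?_, ?_, ?_⟩
  · have k1 := key w i 1 0 zero_le_one le_rfl (by module)
    have k2 := key (w * sg i) j (- A i j) 1 ci zero_le_one (by rw [rt_mul]; module)
    have k3 := key (w * sg i * sg j) i 2 (- A j i) zero_le_two cj (by
      simp only [rt_mul]; funext k
      simp only [Pi.sub_apply, Pi.add_apply, Pi.smul_apply, smul_eq_mul]; grind)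
    have k4 := key (w * sg i * sg j * sg i) j (- A i j) 2 ci zero_le_two (by
      simp only [rt_mul]; funext k
      simp only [Pi.sub_apply, Pi.add_apply, Pi.smul_apply, smul_eq_mul]; grind)
    have k5 := key (w * sg i * sg j * sg i * sg j) i 1 (- A j i) zero_le_one cj (by
      simp only [rt_mul]; funext k
      simp only [Pi.sub_apply, Pi.add_apply, Pi.smul_apply, smul_eq_mul]; grind)
    have k6 := key (w * sg i * sg j * sg i * sg j * sg i) j 0 1 le_rfl zero_le_one (by
      simp only [rt_mul]; funext k
      simp only [Pi.sub_apply, Pi.add_apply, Pi.smul_apply, smul_eq_mul]; grind)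
    unfold mw
    omega
  · intro hd
    rw [desc_iff hA h, (rt_mw hA h hij w).1, neg_nonpos] at hd
    exact rt_ne hA h w i (le_antisymm ((desc_iff hA h).1 hi) hd)
  · intro hd
    rw [desc_iff hA h, (rt_mw hA h hij w).2, neg_nonpos] at hd
    exact rt_ne hA h w j (le_antisymm ((desc_iff hA h).1 hj) hd)

include hA h in
lemma mw_up {i j : Fin n} (hij : i ≠ j) {w : (gcmCoxeter A).Group}
    (hi : ¬ (cs).IsRightDescent w i) (hj : ¬ (cs).IsRightDescent w j) :
    len (mw i j w) = len w + 6 ∧ (cs).IsRightDescent (mw i j w) i ∧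
      (cs).IsRightDescent (mw i j w) j := by
  have a : (cs).IsRightDescent (mw i j w) i := by
    rw [desc_iff hA h, (rt_mw hA h hij w).1, neg_nonpos]; exact rt_nonneg hA h hi
  have b : (cs).IsRightDescent (mw i j w) j := by
    rw [desc_iff hA h, (rt_mw hA h hij w).2, neg_nonpos]; exact rt_nonneg hA h hj
  have := (mw_down hA h hij a b).1
  rw [mw_mw h hij] at this
  exact ⟨this.symm, a, b⟩

lemma fin_len (k : ℕ) : {w : (gcmCoxeter A).Group | len w = k}.Finite := by
  have : {l : List (Fin n) | l.length = k}.Finite := List.finite_length_eq _ k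
  refine (this.image (cs).wordProd).subset ?_
  intro w hw
  obtain ⟨l, hl, rfl⟩ := (cs).exists_isReduced w
  exact ⟨l, hl.symm.trans hw, rfl⟩


open Classical in
/-- generating function of the elements satisfying `p` -/
noncomputable def gf (A : Matrix (Fin n) (Fin n) ℤ) (p : (gcmCoxeter A).Group → Prop) :
    PowerSeries ℤ :=
  PowerSeries.mk fun k => ∑ w ∈ (fin_len (A := A) k).toFinset, if p w then 1 else 0

lemma gf_true : coxPoincare (gcmCoxeter A) = gf A fun _ => True := by
  ext k
  simp only [coxPoincare, gf, PowerSeries.coeff_mk, if_true, Finset.sum_const, nsmul_eq_mul,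
    mul_one]
  norm_cast
  rw [← Set.ncard_eq_toFinset_card _ (fin_len k)]
  rfl

lemma gf_one : gf A (fun w => w = 1) = 1 := by
  ext k
  simp only [gf, PowerSeries.coeff_mk, PowerSeries.coeff_one]
  classical
  trans (if (1 : (gcmCoxeter A).Group) ∈ (fin_len (A := A) k).toFinset then (1 : ℤ) else 0)
  · convert Finset.sum_ite_eq' _ (1 : (gcmCoxeter A).Group) (fun _ => (1 : ℤ))
  · simp [eq_comm]

lemma gf_shift (p q : (gcmCoxeter A).Group → Prop) (d : ℕ)
    (f : (gcmCoxeter A).Group → (gcmCoxeter A).Group) (hf : ∀ w, f (f w) = w)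
    (h1 : ∀ w, p w → len (f w) + d = len w ∧ q (f w))
    (h2 : ∀ w, q w → len (f w) = len w + d ∧ p (f w)) :
    gf A p = X ^ d * gf A q := by
  classical
  ext k
  rw [PowerSeries.coeff_X_pow_mul']
  simp only [gf, PowerSeries.coeff_mk]
  split_ifs with hd
  · rw [← Finset.sum_filter, ← Finset.sum_filter]
    refine Finset.sum_nbij' f f ?_ ?_ ?_ ?_ ?_
    · intro w hw
      simp only [Finset.mem_filter, Set.Finite.mem_toFinset, Set.mem_ofPred_eq] at hw ⊢
      have := h1 w hw.2
      exact ⟨by omega, this.2⟩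
    · intro w hw
      simp only [Finset.mem_filter, Set.Finite.mem_toFinset, Set.mem_ofPred_eq] at hw ⊢
      have := h2 w hw.2
      exact ⟨by omega, this.2⟩
    · intro w _; exact hf w
    · intro w _; exact hf w
    · intro w _; rfl
  · refine Finset.sum_eq_zero fun w hw => ?_
    simp only [Set.Finite.mem_toFinset, Set.mem_ofPred_eq] at hw
    rw [if_neg]
    intro hp
    have := (h1 w hp).1
    omega

lemma gf_desc (i : Fin n) : (1 + X) * gf A (fun w => (cs).IsRightDescent w i)
    = X * gf A (fun _ => True) := by
  have a := gf_shift (A := A) (fun w => (cs).IsRightDescent w i)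
    (fun w => ¬ (cs).IsRightDescent w i) 1 (fun w => w * sg i)
    (fun w => (cs).simple_mul_simple_cancel_right i)
    (fun w hw => ⟨(cs).isRightDescent_iff.1 hw,
      (cs).isRightDescent_iff_not_isRightDescent_mul.1 hw⟩)
    (fun w hw => ⟨(cs).not_isRightDescent_iff.1 hw, by
      rw [(cs).isRightDescent_iff_not_isRightDescent_mul,
        (cs).simple_mul_simple_cancel_right]; exact hw⟩)
  have b : gf A (fun w => (cs).IsRightDescent w i) + gf A (fun w => ¬ (cs).IsRightDescent w i)
      = gf A (fun _ => True) := by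
    ext k
    simp only [gf, map_add, PowerSeries.coeff_mk, ← Finset.sum_add_distrib]
    refine Finset.sum_congr rfl fun w _ => ?_
    by_cases hw : (cs).IsRightDescent w i <;> simp [hw]
  rw [← b]
  linear_combination a

include hA h in
lemma gf_desc2 {i j : Fin n} (hij : i ≠ j) :
    (1 + X) * (1 + X + X ^ 2 + X ^ 3 + X ^ 4 + X ^ 5) *
      gf A (fun w => (cs).IsRightDescent w i ∧ (cs).IsRightDescent w j)
    = X ^ 6 * gf A (fun _ => True) := by
  have a := gf_shift (A := A) (fun w => (cs).IsRightDescent w i ∧ (cs).IsRightDescent w j)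
    (fun w => ¬ (cs).IsRightDescent w i ∧ ¬ (cs).IsRightDescent w j) 6 (mw i j)
    (mw_mw h hij) (fun w hw => mw_down hA h hij hw.1 hw.2) (fun w hw => mw_up hA h hij hw.1 hw.2)
  have b : gf A (fun w => (cs).IsRightDescent w i) + gf A (fun w => (cs).IsRightDescent w j)
      + gf A (fun w => ¬ (cs).IsRightDescent w i ∧ ¬ (cs).IsRightDescent w j)
      = gf A (fun _ => True)
      + gf A (fun w => (cs).IsRightDescent w i ∧ (cs).IsRightDescent w j) := by
    ext k
    simp only [gf, map_add, PowerSeries.coeff_mk, ← Finset.sum_add_distrib]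
    refine Finset.sum_congr rfl fun w _ => ?_
    by_cases hw : (cs).IsRightDescent w i <;> by_cases hw' : (cs).IsRightDescent w j <;>
      simp [hw, hw']
  have ci := gf_desc (A := A) i
  have cj := gf_desc (A := A) j
  have hx : (1 - X : PowerSeries ℤ) ≠ 0 := by
    intro h0
    have := congrArg PowerSeries.constantCoeff h0
    simp at this
  apply mul_left_cancel₀ hx
  linear_combination (1 + X) * a + (1 + X) * X ^ 6 * b - X ^ 6 * ci - X ^ 6 * cj

include hA h in
lemma gf_main : 2 * gf A (fun _ => True) - 2 * ∑ i, gf A (fun w => (cs).IsRightDescent w i)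
    + ∑ x ∈ (Finset.univ : Finset (Fin n)).offDiag,
        gf A (fun w => (cs).IsRightDescent w x.1 ∧ (cs).IsRightDescent w x.2) = 2 := by
  classical
  rw [show (2 : PowerSeries ℤ) = PowerSeries.C 2 from (map_ofNat _ 2).symm]
  rw [← mul_one (PowerSeries.C (2 : ℤ)), ← gf_one (A := A)]
  ext k
  simp only [gf_one, mul_one]
  rw [← mul_one (PowerSeries.C (2 : ℤ)), ← gf_one (A := A)]
  simp only [gf_one, mul_one]
  simp only [map_add, map_sub, map_sum, PowerSeries.coeff_C_mul]
  rw [← mul_one (PowerSeries.C (2 : ℤ)), PowerSeries.coeff_C_mul, ← gf_one (A := A)]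
  simp only [gf, PowerSeries.coeff_mk]
  rw [Finset.sum_comm, Finset.sum_comm (s := Finset.offDiag _)]
  simp only [Finset.mul_sum (s := Set.Finite.toFinset _), ← Finset.sum_add_distrib,
    ← Finset.sum_sub_distrib]
  refine Finset.sum_congr rfl fun w _ => ?_
  set D := Finset.univ.filter fun i => (cs).IsRightDescent w i with hD
  have e1 : (∑ i, if (cs).IsRightDescent w i then (1 : ℤ) else 0) = D.card := by
    simp [hD]
  have e2 : (∑ x ∈ (Finset.univ : Finset (Fin n)).offDiag,
      @ite ℤ ((cs).IsRightDescent w x.1 ∧ (cs).IsRightDescent w x.2)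
        (Classical.propDecidable _) 1 0)
      = D.offDiag.card := by
    trans (∑ x ∈ (Finset.univ : Finset (Fin n)).offDiag,
      if (cs).IsRightDescent w x.1 ∧ (cs).IsRightDescent w x.2 then (1 : ℤ) else 0)
    · refine Finset.sum_congr rfl fun x _ => ?_
      congr
    rw [Finset.sum_boole]
    congr 2
    ext x
    simp [hD, Finset.mem_offDiag]
    tauto
  rw [e1, e2, Finset.offDiag_card]
  have hle : D.card ≤ 2 := by
    by_contra hc
    obtain ⟨a, b, c, ha, hb, hc, hab, hac, hbc⟩ := Finset.two_lt_card_iff.1 (not_le.1 hc)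
    simp only [hD, Finset.mem_filter, Finset.mem_univ, true_and] at ha hb hc
    exact no_three hA h w a b c hab hac hbc ha hb hc
  have h0 : D.card = 0 ↔ w = 1 := by
    rw [Finset.card_eq_zero, hD, Finset.filter_eq_empty_iff]
    constructor
    · intro hh
      by_contra hw
      obtain ⟨i, hi⟩ := (cs).exists_rightDescent_of_ne_one hw
      exact hh (Finset.mem_univ i) hi
    · rintro rfl i _
      exact (cs).not_isRightDescent_one i
  by_cases hw : w = 1
  · simp [hw, h0.2 hw]
  · have : D.card ≠ 0 := fun h' => hw (h0.1 h')
    have : D.card = 1 ∨ D.card = 2 := by omega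
    rcases this with h' | h' <;> simp [h', hw]

end helpers


/-- for an `n × n` generalized Cartan matrix (`n ≥ 2`) with
`aᵢⱼ·aⱼᵢ = 3` for all `i ≠ j`,
`(((n−1)(n−2)/2)·t⁶ − (n−2)·(t⁵+t⁴+t³+t²+t) + 1)·P(A) = (1+t)(1+t+t²+t³+t⁴+t⁵)`. -/
theorem poincare_all_products_three {n : ℕ} (hn : 2 ≤ n)
    (A : Matrix (Fin n) (Fin n) ℤ) (hA : IsGCM A)
    (h : ∀ i j, i ≠ j → A i j * A j i = 3) :
    ((((n - 1) * (n - 2) / 2 : ℕ) : PowerSeries ℤ) * X ^ 6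
        - ((n - 2 : ℕ) : PowerSeries ℤ) * (X ^ 5 + X ^ 4 + X ^ 3 + X ^ 2 + X) + 1)
        * coxPoincare (gcmCoxeter A)
      = (1 + X) * (1 + X + X ^ 2 + X ^ 3 + X ^ 4 + X ^ 5) := by

  have m := gf_main hA h
  rw [gf_true]
  set W := gf A (fun _ => True)
  set Q : PowerSeries ℤ := 1 + X + X ^ 2 + X ^ 3 + X ^ 4 + X ^ 5 with hQ
  have s1 : (1 + X) * ∑ i, gf A (fun w => (gcmCoxeter A).toCoxeterSystem.IsRightDescent w i)
      = (n : PowerSeries ℤ) * (X * W) := by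
    rw [Finset.mul_sum, Finset.sum_congr rfl fun i _ => gf_desc (A := A) i]
    simp [W]
  have s2 : (1 + X) * Q * ∑ x ∈ (Finset.univ : Finset (Fin n)).offDiag,
        gf A (fun w => (gcmCoxeter A).toCoxeterSystem.IsRightDescent w x.1 ∧
          (gcmCoxeter A).toCoxeterSystem.IsRightDescent w x.2)
      = ((n * n - n : ℕ) : PowerSeries ℤ) * (X ^ 6 * W) := by
    rw [Finset.mul_sum, Finset.sum_congr rfl fun x hx =>
      gf_desc2 hA h (Finset.mem_offDiag.1 hx).2.2]
    rw [Finset.sum_const, Finset.offDiag_card]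
    simp [W]
  obtain ⟨m', rfl⟩ : ∃ m', n = m' + 2 := ⟨n - 2, by omega⟩
  have e1 : (m' + 2) * (m' + 2) - (m' + 2) = (m' + 2) * (m' + 1) := by
    rw [show (m' + 2) * (m' + 2) = (m' + 2) * (m' + 1) + (m' + 2) by ring]; omega
  have e2 : m' + 2 - 2 = m' := by omega
  have e3 : m' + 2 - 1 = m' + 1 := by omega
  have e4 : 2 * ((m' + 1) * m' / 2) = (m' + 1) * m' :=
    Nat.mul_div_cancel' (by rw [mul_comm]; exact (Nat.even_mul_succ_self m').two_dvd)
  rw [e1] at s2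
  rw [e2, e3]
  have e5 := congrArg (fun z : ℕ => (z : PowerSeries ℤ)) e4
  push_cast at e5 s1 s2
  have hx : (2 : PowerSeries ℤ) ≠ 0 := by
    intro h0
    have := congrArg PowerSeries.constantCoeff h0
    rw [map_ofNat, map_zero] at this
    norm_num at this
  apply mul_left_cancel₀ hx
  generalize (((m' + 1) * m' / 2 : ℕ) : PowerSeries ℤ) = c at *
  linear_combination (exp := 1) (1 + X) * Q * m + 2 * Q * s1 - s2 + X ^ 6 * W * e5
end

section
/- Let M=(m_{ij}) and M'=(m'_{ij}) be Coxeter matrices on {1,…,n} with all off-diagonal entries in {3,4,6,∞} (i.e., m_{ij} ≥ 3 and m'_{ij} ≥ 3 for all i≠j), and suppose there is a bijection φ of the set of pairs {(i,j) : 1 ≤ j < i ≤ n} onto itself such that m'_{ij} = m_{φ(i,j)} for all j < i (i.e., the multisets of below-diagonal entries of M and M' coincide). Then the Poincaré series of the Coxeter groups of M and M' are equal. -/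
open PowerSeries

namespace CoxPf

theorem end_one {X : Type*} (x : X) : (1 : Function.End X) x = x := rfl

open Finset

variable {B W : Type*} [Group W] {M : CoxeterMatrix B} (cs : CoxeterSystem M W)

def altG {G : Type*} [Monoid G] (f : B → G) : B → B → ℕ → G
  | _, _, 0 => 1
  | a, b, k + 1 => altG f b a k * f b

theorem altG_zero {G : Type*} [Monoid G] (f : B → G) (a b : B) : altG f a b 0 = 1 := rfl

theorem altG_succ {G : Type*} [Monoid G] (f : B → G) (a b : B) (k : ℕ) :
    altG f a b (k + 1) = altG f b a k * f b := rfl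

theorem pow_eq_altG {G : Type*} [Monoid G] (f : B → G) (a b : B) (k : ℕ) :
    (f a * f b) ^ k = altG f a b (2 * k) := by
  induction k with
  | zero => simp [altG]
  | succ k ih =>
    rw [pow_succ, ih, show 2 * (k + 1) = 2 * k + 1 + 1 by ring, altG_succ, altG_succ, mul_assoc]

theorem altG_eq_wordProd (a b : B) (k : ℕ) :
    altG cs.simple a b k = cs.wordProd (CoxeterSystem.alternatingWord a b k) := by
  induction k generalizing a b with
  | zero => simp [altG, CoxeterSystem.alternatingWord]
  | succ k ih => rw [altG_succ, ih, CoxeterSystem.alternatingWord_succ, cs.wordProd_concat]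

theorem altG_braid (a b : B) :
    altG cs.simple a b (M a b) = altG cs.simple b a (M a b) := by
  rw [altG_eq_wordProd, altG_eq_wordProd]
  have := cs.wordProd_braidWord_eq a b
  unfold CoxeterSystem.braidWord at this
  rw [this, M.symmetric b a]

open Classical in
noncomputable def cxF (i : B) : Function.End (W × ZMod 2) :=
  fun p => (cs.simple i * p.1 * cs.simple i, p.2 + if p.1 = cs.simple i then 1 else 0)

theorem conj_pow_aux (a b : B) (t : W) (l : ℕ) :
    (cs.simple b * t * cs.simple b = cs.simple a * (cs.simple b * cs.simple a) ^ l) ↔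
      t = cs.simple b * (cs.simple a * cs.simple b) ^ (l + 1) := by
  have h : cs.simple b * (cs.simple a * cs.simple b) ^ (l + 1) =
      cs.simple b * (cs.simple a * (cs.simple b * cs.simple a) ^ l) * cs.simple b := by
    have : (cs.simple a * cs.simple b) ^ (l + 1) =
        cs.simple a * (cs.simple b * cs.simple a) ^ l * cs.simple b := by
      induction l with
      | zero => simp
      | succ l ih => rw [pow_succ, ih, pow_succ]; simp [mul_assoc]
    rw [this]; simp [mul_assoc]
  rw [h]
  constructor
  · intro h'; rw [← h']; simp [mul_assoc]
  · intro h'; rw [h']; simp [mul_assoc]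

open Classical in
theorem altG_cxF (a b : B) (k : ℕ) (t : W) (e : ZMod 2) :
    altG (cxF cs) a b k (t, e) =
      (altG cs.simple a b k * t * (altG cs.simple a b k)⁻¹,
        e + ∑ l ∈ range k, if t = cs.simple b * (cs.simple a * cs.simple b) ^ l then 1 else 0) := by
  induction k generalizing a b t e with
  | zero => simp [altG, end_one]
  | succ k ih =>
    have h1 : altG (cxF cs) a b (k + 1) (t, e) = altG (cxF cs) b a k (cxF cs b (t, e)) := rfl
    rw [h1, cxF, ih, altG_succ, Finset.sum_range_succ']
    simp only [conj_pow_aux]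
    ext
    · simp [mul_assoc]
    · simp only [pow_zero, mul_one]; ring

theorem cxF_liftable : M.IsLiftable (cxF cs) := by
  classical
  intro a b
  rw [pow_eq_altG]
  funext p
  obtain ⟨t, e⟩ := p
  rw [altG_cxF, ← pow_eq_altG, cs.simple_mul_simple_pow, two_mul, Finset.sum_range_add]
  simp only [pow_add, cs.simple_mul_simple_pow, one_mul]
  simp [CharTwo.add_self_eq_zero, end_one]

noncomputable def cxH : W →* Function.End (W × ZMod 2) := cs.lift ⟨cxF cs, cxF_liftable cs⟩

noncomputable def eta (w t : W) : ZMod 2 := (cxH cs w (t, 0)).2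

theorem cxH_simple (i : B) : cxH cs (cs.simple i) = cxF cs i := cs.lift_apply_simple _ i

theorem cxH_mul (w v : W) (p) : cxH cs (w * v) p = cxH cs w (cxH cs v p) := by
  rw [map_mul]; rfl

theorem cxH_apply (w t : W) (e : ZMod 2) : cxH cs w (t, e) = (w * t * w⁻¹, e + eta cs w t) := by
  revert t e
  refine cs.simple_induction_left (p := fun w => ∀ t e, cxH cs w (t, e) = (w * t * w⁻¹, e + eta cs w t)) w ?_ ?_
  · intro t e; simp [eta, end_one]
  · intro w i ih t e
    unfold eta
    rw [cxH_mul, cxH_mul, ih, ih, cxH_simple]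
    simp [cxF, mul_assoc, add_assoc]

theorem eta_mul (w v t : W) : eta cs (w * v) t = eta cs v t + eta cs w (v * t * v⁻¹) := by
  conv_lhs => unfold eta
  rw [cxH_mul, cxH_apply, cxH_apply]; simp

open Classical in
theorem eta_simple (i : B) (t : W) : eta cs (cs.simple i) t = if t = cs.simple i then 1 else 0 := by
  unfold eta
  rw [cxH_simple]; simp [cxF]

theorem mem_ris (ω : List B) (t : W) (h : eta cs (cs.wordProd ω) t ≠ 0) : t ∈ cs.rightInvSeq ω := by
  classical
  induction ω with
  | nil => simp [eta, end_one] at h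
  | cons i ω ih =>
    rw [cs.wordProd_cons, eta_mul, eta_simple] at h
    rw [CoxeterSystem.rightInvSeq, List.mem_cons]
    by_cases h' : eta cs (cs.wordProd ω) t = 0
    · left
      rw [h'] at h
      have : cs.wordProd ω * t * (cs.wordProd ω)⁻¹ = cs.simple i := by
        by_contra h2; simp [h2] at h
      rw [← this]; group
    · right; exact ih h'

theorem lt_of_eta (w t : W) (h : eta cs w t ≠ 0) : cs.length (w * t) < cs.length w := by
  obtain ⟨ω, hω, rfl⟩ := cs.exists_isReduced w
  exact (cs.isRightInversion_of_mem_rightInvSeq hω (mem_ris cs ω t h)).2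

theorem desc_iff (w : W) (i : B) : cs.IsRightDescent w i ↔ eta cs w (cs.simple i) ≠ 0 := by
  constructor
  · intro h h0
    have := lt_of_eta cs (w * cs.simple i) (cs.simple i) (by
      rw [eta_mul, eta_simple]; simp [h0])
    rw [cs.simple_mul_simple_cancel_right] at this
    unfold CoxeterSystem.IsRightDescent at h
    omega
  · exact lt_of_eta cs _ _

theorem eta_altG (a b : B) (k : ℕ) (h : eta cs (altG cs.simple a b k) (cs.simple a) ≠ 0) :
    ∃ l < k, (cs.simple a * cs.simple b) ^ (l + 1) = 1 := by
  classical
  have hH : cxH cs (altG cs.simple a b k) = altG (cxF cs) a b k := by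
    clear h
    induction k generalizing a b with
    | zero => simp [altG]
    | succ k ih => rw [altG_succ, altG_succ, map_mul, ih, cxH_simple]
  unfold eta at h
  rw [hH, altG_cxF] at h
  simp only [zero_add] at h
  obtain ⟨l, hl, h2⟩ := Finset.exists_ne_zero_of_sum_ne_zero h
  refine ⟨l, Finset.mem_range.1 hl, ?_⟩
  have h3 : cs.simple a = cs.simple b * (cs.simple a * cs.simple b) ^ l := by
    by_contra h3; simp [h3] at h2
  rw [pow_succ', mul_assoc, ← h3]; simp

/-- order hypothesis -/
def OrdOK : Prop := ∀ a b : B, a ≠ b → ∀ l : ℕ, 0 < l → (M a b = 0 ∨ l < M a b) →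
  (cs.simple a * cs.simple b) ^ l ≠ 1

def K (a b : B) : Subgroup W := Subgroup.closure {cs.simple a, cs.simple b}

def IsMin (a b : B) (v : W) : Prop := ∀ u ∈ K cs a b, cs.length v ≤ cs.length (v * u)

theorem K_symm (a b : B) : K cs a b = K cs b a := by
  unfold K; rw [Set.pair_comm]

variable {cs}

theorem IsMin.symm {a b : B} {v : W} (h : IsMin cs a b v) : IsMin cs b a v := by
  unfold IsMin; rw [K_symm]; exact h

theorem left_mem_K (a b : B) : cs.simple a ∈ K cs a b := Subgroup.subset_closure (by simp)

theorem right_mem_K (a b : B) : cs.simple b ∈ K cs a b := Subgroup.subset_closure (by simp)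

theorem altG_mem (a b : B) (k : ℕ) : altG cs.simple a b k ∈ K cs a b := by
  induction k generalizing a b with
  | zero => exact one_mem _
  | succ k ih =>
    rw [altG_succ]; exact mul_mem (by rw [K_symm]; exact ih b a) (right_mem_K a b)

theorem R1 (ho : OrdOK cs) {a b : B} (hab : a ≠ b) {v : W} (hv : IsMin cs a b v) {k : ℕ}
    (hk : M a b = 0 ∨ k < M a b) : ¬ cs.IsRightDescent (v * altG cs.simple a b k) a := by
  rw [desc_iff, not_not, eta_mul]
  have h1 : eta cs (altG cs.simple a b k) (cs.simple a) = 0 := by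
    by_contra h
    obtain ⟨l, hl, h2⟩ := eta_altG cs a b k h
    exact ho a b hab (l + 1) (by omega) (by omega) h2
  rw [h1, zero_add]
  by_contra h
  have := lt_of_eta cs _ _ h
  have h2 := hv (altG cs.simple a b k * cs.simple a * (altG cs.simple a b k)⁻¹)
    (mul_mem (mul_mem (altG_mem a b k) (left_mem_K a b)) (inv_mem (altG_mem a b k)))
  omega

theorem R2 (ho : OrdOK cs) {a b : B} (hab : a ≠ b) {v : W} (hv : IsMin cs a b v) {k : ℕ}
    (hk : M a b = 0 ∨ k < M a b) : cs.IsRightDescent (v * altG cs.simple a b (k + 1)) b := by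
  have := R1 ho hab.symm hv.symm (k := k) (by rwa [M.symmetric])
  rw [cs.isRightDescent_iff_not_isRightDescent_mul, altG_succ, ← mul_assoc,
    cs.simple_mul_simple_cancel_right]
  exact this

theorem Rlen (ho : OrdOK cs) {a b : B} (hab : a ≠ b) {v : W} (hv : IsMin cs a b v) {k : ℕ}
    (hk : M a b = 0 ∨ k ≤ M a b) : cs.length (v * altG cs.simple a b k) = cs.length v + k := by
  induction k generalizing a b with
  | zero => simp [altG, end_one]
  | succ k ih =>
    have h1 := R1 ho hab.symm hv.symm (k := k) (by rw [M.symmetric]; omega)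
    rw [cs.not_isRightDescent_iff, ih hab.symm hv.symm (by rw [M.symmetric]; omega), mul_assoc] at h1
    rw [altG_succ, h1]; ring

theorem K_form {a b : B} {u : W} (hu : u ∈ K cs a b) :
    ∃ k, (M a b = 0 ∨ k ≤ M a b) ∧ (u = altG cs.simple a b k ∨ u = altG cs.simple b a k) := by
  have key : ∀ (a b : B) (u : W), (∃ k, (M a b = 0 ∨ k ≤ M a b) ∧
      (u = altG cs.simple a b k ∨ u = altG cs.simple b a k)) →
      (∃ k, (M a b = 0 ∨ k ≤ M a b) ∧
      (u * cs.simple b = altG cs.simple a b k ∨ u * cs.simple b = altG cs.simple b a k)) := by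
    intro a b u ⟨k, hk, h⟩
    have h1 : ∀ k, (M a b = 0 ∨ k ≤ M a b) → u = altG cs.simple a b k → k ≠ 0 → (∃ k, (M a b = 0 ∨ k ≤ M a b) ∧
      (u * cs.simple b = altG cs.simple a b k ∨ u * cs.simple b = altG cs.simple b a k)) := by
      intro k hk h h0
      obtain ⟨k, rfl⟩ := Nat.exists_eq_succ_of_ne_zero h0
      refine ⟨k, by omega, Or.inr ?_⟩
      rw [h, Nat.succ_eq_add_one, altG_succ, cs.simple_mul_simple_cancel_right]
    have h2 : u = altG cs.simple b a k → (∃ k, (M a b = 0 ∨ k ≤ M a b) ∧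
      (u * cs.simple b = altG cs.simple a b k ∨ u * cs.simple b = altG cs.simple b a k)) := by
      intro h
      by_cases hkm : M a b = 0 ∨ k < M a b
      · exact ⟨k + 1, by omega, Or.inl (by rw [h, altG_succ])⟩
      · have hkm' : k = M a b := by omega
        rw [hkm', ← altG_braid] at h
        exact h1 _ (by omega) h (by omega)
    rcases h with h | h
    · by_cases h0 : k = 0
      · apply h2; rw [h, h0]; rfl
      · exact h1 k hk h h0
    · exact h2 h
  have keyR : ∀ u : W, (∃ k, (M a b = 0 ∨ k ≤ M a b) ∧
      (u = altG cs.simple a b k ∨ u = altG cs.simple b a k)) → ∀ y ∈ ({cs.simple a, cs.simple b} : Set W),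
      (∃ k, (M a b = 0 ∨ k ≤ M a b) ∧
      (u * y = altG cs.simple a b k ∨ u * y = altG cs.simple b a k)) := by
    intro u h y hy
    rcases hy with rfl | rfl
    · have := key b a u (by rw [M.symmetric]; simpa only [or_comm] using h)
      rw [M.symmetric] at this; simpa only [or_comm] using this
    · exact key a b u h
  refine Subgroup.closure_induction_right (p := fun u _ => ∃ k, (M a b = 0 ∨ k ≤ M a b) ∧
      (u = altG cs.simple a b k ∨ u = altG cs.simple b a k)) ⟨0, by omega, Or.inl rfl⟩ ?_ ?_ hu
  · intro x _ y hy h; exact keyR x h y hy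
  · intro x _ y hy h
    have : y⁻¹ = y := by rcases hy with rfl | rfl <;> simp
    rw [this]; exact keyR x h y hy

theorem R3 (a b : B) (w : W) : ∃ v, IsMin cs a b v ∧ ∃ k, (M a b = 0 ∨ k ≤ M a b) ∧
    (w = v * altG cs.simple a b k ∨ w = v * altG cs.simple b a k) := by
  obtain ⟨⟨u, hu⟩, h⟩ : ∃ u : K cs a b, ∀ u' : K cs a b, cs.length (w * u) ≤ cs.length (w * u') :=
    ⟨Function.argmin (fun u : K cs a b => cs.length (w * u)),
      fun u' => not_lt.1 (Function.not_lt_argmin (fun u : K cs a b => cs.length (w * u)) u')⟩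
  refine ⟨w * u, ?_, ?_⟩
  · intro u' hu'
    have := h ⟨u * u', mul_mem hu hu'⟩
    simpa [mul_assoc] using this
  · obtain ⟨k, hk, h'⟩ := K_form (inv_mem hu)
    refine ⟨k, hk, ?_⟩
    rcases h' with h' | h'
    · left; rw [← h']; simp
    · right; rw [← h']; simp

theorem R4 (ho : OrdOK cs) {a b : B} (hab : a ≠ b) {v : W} (ha : ¬ cs.IsRightDescent v a)
    (hb : ¬ cs.IsRightDescent v b) : IsMin cs a b v := by
  obtain ⟨v', hv, k, hk, h⟩ := R3 (cs := cs) a b v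
  rcases k with _ | k
  · have : v = v' := by simpa [altG] using h
    rwa [this]
  · rcases h with h | h
    · exact absurd (h ▸ R2 ho hab hv (by omega)) hb
    · exact absurd (h ▸ R2 ho hab.symm hv.symm (by rw [M.symmetric]; omega)) ha

theorem R5 (ho : OrdOK cs) {a b : B} (hab : a ≠ b) {w : W} (ha : cs.IsRightDescent w a)
    (hb : cs.IsRightDescent w b) : M a b ≠ 0 ∧ ∃ v, IsMin cs a b v ∧
      w = v * altG cs.simple a b (M a b) := by
  obtain ⟨v', hv, k, hk, h⟩ := R3 (cs := cs) a b w
  have hk' : ¬ (M a b = 0 ∨ k < M a b) := by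
    intro hk'
    rcases h with h | h
    · exact R1 ho hab hv hk' (h ▸ ha)
    · exact R1 ho hab.symm hv.symm (by rwa [M.symmetric]) (h ▸ hb)
  have : k = M a b := by omega
  refine ⟨by omega, v', hv, ?_⟩
  subst this
  rw [← altG_braid, or_self] at h
  exact h

theorem R6 (ho : OrdOK cs) {a b : B} (hab : a ≠ b) {v : W} (hv : IsMin cs a b v)
    (hm : M a b ≠ 0) : cs.IsRightDescent (v * altG cs.simple a b (M a b)) a ∧
      cs.IsRightDescent (v * altG cs.simple a b (M a b)) b := by
  constructor
  · rw [altG_braid]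
    have := R2 ho hab.symm hv.symm (k := M a b - 1) (by rw [M.symmetric]; omega)
    rwa [Nat.sub_add_cancel (by omega)] at this
  · have := R2 ho hab hv (k := M a b - 1) (by omega)
    rwa [Nat.sub_add_cancel (by omega)] at this

theorem C2 (ho : OrdOK cs) {a b : B} (hab : a ≠ b) {w : W} (ha : cs.IsRightDescent w a)
    (hb : cs.IsRightDescent w b) (hm : M a b ≠ 1 ∧ M a b ≠ 2) :
    cs.IsRightDescent (w * cs.simple a) b ∧
    cs.IsRightDescent (w * cs.simple a * cs.simple b) a := by
  obtain ⟨h0, v, hv, h⟩ := R5 ho hab ha hb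
  obtain ⟨k, hk⟩ : ∃ k, M a b = k + 3 := ⟨M a b - 3, by omega⟩
  rw [altG_braid, hk, altG_succ, ← mul_assoc] at h
  have h1 : w * cs.simple a = v * altG cs.simple a b (k + 2) := by
    rw [h, cs.simple_mul_simple_cancel_right]
  have h2 : w * cs.simple a * cs.simple b = v * altG cs.simple b a (k + 1) := by
    rw [h1, altG_succ, ← mul_assoc, cs.simple_mul_simple_cancel_right]
  rw [h2, h1]
  exact ⟨R2 ho hab hv (by omega), R2 ho hab.symm hv.symm (by rw [M.symmetric]; omega)⟩

theorem C3 (ho : OrdOK cs) (hm : ∀ a b, a ≠ b → M a b ≠ 1 ∧ M a b ≠ 2) (N : ℕ) :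
    ∀ (y : W) (a b c : B), cs.length y = N → a ≠ b → b ≠ c → a ≠ c →
    cs.IsRightDescent y c → cs.IsRightDescent y a → cs.IsRightDescent (y * cs.simple c) a →
    cs.IsRightDescent (y * cs.simple c) b → False := by
  induction N using Nat.strong_induction_on with
  | _ N ih =>
    intro y a b c hN hab hbc hac h1 h2 h3 h4
    have hlt : cs.length (y * cs.simple c) < N := hN ▸ h1
    exact ih _ hlt (y * cs.simple c) b c a rfl hbc hac.symm hab.symm h3 h4
      (C2 ho hab h3 h4 (hm _ _ hab)).1 (C2 ho hac.symm h1 h2 (hm _ _ hac.symm)).2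

theorem C4 (ho : OrdOK cs) (hm : ∀ a b, a ≠ b → M a b ≠ 1 ∧ M a b ≠ 2)
    {w : W} {a b c : B} (hab : a ≠ b) (hbc : b ≠ c) (hac : a ≠ c)
    (ha : cs.IsRightDescent w a) (hb : cs.IsRightDescent w b) (hc : cs.IsRightDescent w c) :
    False :=
  C3 ho hm _ w a b c rfl hab hbc hac hc ha (C2 ho hac.symm hc ha (hm _ _ hac.symm)).1
    (C2 ho hbc.symm hc hb (hm _ _ hbc.symm)).1

end CoxPf
namespace CoxPf

section rep
variable {n : ℕ} (M : CoxeterMatrix (Fin n))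

def cval (m : ℕ) : ℤ := if m = 3 then 1 else if m = 4 then 2 else if m = 6 then 3 else 4

def cart (i j : Fin n) : ℤ := if i = j then 2 else if i < j then -1 else - cval (M i j)

def rf (i : Fin n) : Function.End (Fin n → ℤ) := fun x k => x k - cart M i k * x i

theorem rf_apply (i : Fin n) (x : Fin n → ℤ) (k : Fin n) : rf M i x k = x k - cart M i k * x i := rfl

theorem end_mul {X : Type*} (f g : Function.End X) (x : X) : (f * g) x = f (g x) := rfl

theorem cart_self (i : Fin n) : cart M i i = 2 := by simp [cart]

theorem rf_liftable
    (hM : ∀ i j : Fin n, i ≠ j → M i j = 3 ∨ M i j = 4 ∨ M i j = 6 ∨ M i j = 0) :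
    M.IsLiftable (rf M) := by
  intro i j
  by_cases hij : i = j
  · subst hij
    rw [M.diagonal, pow_one]
    funext x k
    rw [end_mul, rf_apply, rf_apply, rf_apply, cart_self]
    change _ = x k
    ring
  · have hs := M.symmetric j i
    have hc : (cart M i j = -1 ∧ cart M j i = - cval (M i j)) ∨
        (cart M j i = -1 ∧ cart M i j = - cval (M i j)) := by
      rcases lt_or_gt_of_ne hij with h | h
      · left; simp [cart, hij, h, h.not_gt, hs, Ne.symm hij]
      · right; simp [cart, hij, h, h.not_gt, Ne.symm hij]
    rcases hM i j hij with h | h | h | h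
    all_goals
      rw [h] at hc ⊢
      simp only [cval] at hc
      norm_num at hc
      funext x k
      try simp only [pow_succ, pow_zero, one_mul, end_mul, rf_apply, cart_self]
      try change _ = x k
      try rcases hc with ⟨h1, h2⟩ | ⟨h1, h2⟩ <;> simp only [h1, h2] <;> ring

theorem rf_ord
    (hM : ∀ i j : Fin n, i ≠ j → M i j = 3 ∨ M i j = 4 ∨ M i j = 6 ∨ M i j = 0)
    (i j : Fin n) (hij : i < j) (l : ℕ) (hl : 0 < l) (hlm : M i j = 0 ∨ l < M i j) :
    (rf M i * rf M j) ^ l ≠ 1 := by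
  have hs := M.symmetric j i
  have hne := hij.ne
  have h1 : cart M i j = -1 := by simp [cart, hij, hne]
  have h2 : cart M j i = - cval (M i j) := by simp [cart, hij.not_gt, hs, hne.symm]
  intro hcon
  have hx : ∀ x : Fin n → ℤ, ((rf M i * rf M j) ^ l) x = x := fun x => by rw [hcon]; rfl
  obtain ⟨x, hxi, hxj⟩ : ∃ x : Fin n → ℤ, x i = 1 ∧ x j = 0 :=
    ⟨fun k => if k = i then 1 else 0, by simp, by simp [hne.symm]⟩
  rcases hM i j hne with h | h | h | h
  · rw [h] at h2 hlm
    simp only [cval] at h2; norm_num at h2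
    have e1 := congrFun (hx x) j
    have e2 := congrFun (hx x) i
    have : l < 3 := by omega
    interval_cases l <;>
    simp only [pow_succ, pow_zero, one_mul, end_mul, end_one, rf_apply, cart_self, h1, h2, hxi, hxj] at e1 e2 <;> omega
  · rw [h] at h2 hlm
    simp only [cval] at h2; norm_num at h2
    have e1 := congrFun (hx x) j
    have e2 := congrFun (hx x) i
    have : l < 4 := by omega
    interval_cases l <;>
    simp only [pow_succ, pow_zero, one_mul, end_mul, end_one, rf_apply, cart_self, h1, h2, hxi, hxj] at e1 e2 <;> omega
  · rw [h] at h2 hlm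
    simp only [cval] at h2; norm_num at h2
    have e1 := congrFun (hx x) j
    have e2 := congrFun (hx x) i
    have : l < 6 := by omega
    interval_cases l <;>
    simp only [pow_succ, pow_zero, one_mul, end_mul, end_one, rf_apply, cart_self, h1, h2, hxi, hxj] at e1 e2 <;> omega
  · rw [h] at h2
    simp only [cval] at h2; norm_num at h2
    have key : ∀ l : ℕ, ((rf M i * rf M j) ^ l) x j = l ∧
        ((rf M i * rf M j) ^ l) x i + 2 * ((rf M i * rf M j) ^ l) x j = 1 := by
      intro l
      induction l with
      | zero =>
        have : ((rf M i * rf M j) ^ 0) x = x := rfl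
        rw [this]; simp [hxi, hxj]
      | succ l ih =>
        rw [pow_succ', end_mul, end_mul]
        simp only [rf_apply, cart_self, h1, h2]
        push_cast
        constructor <;> linarith [ih.1, ih.2]
    have := (key l).1
    rw [hx, hxj] at this
    omega

theorem ordOK
    (hM : ∀ i j : Fin n, i ≠ j → M i j = 3 ∨ M i j = 4 ∨ M i j = 6 ∨ M i j = 0) :
    OrdOK M.toCoxeterSystem := by
  have main : ∀ i j : Fin n, i < j → ∀ l : ℕ, 0 < l → (M i j = 0 ∨ l < M i j) →
      (M.toCoxeterSystem.simple i * M.toCoxeterSystem.simple j) ^ l ≠ 1 := by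
    intro i j hij l hl hlm h
    apply rf_ord M hM i j hij l hl hlm
    have := congrArg (M.toCoxeterSystem.lift ⟨rf M, rf_liftable M hM⟩) h
    rwa [map_pow, map_mul, CoxeterSystem.lift_apply_simple, CoxeterSystem.lift_apply_simple,
      map_one] at this
  intro a b hab l hl hlm h
  rcases lt_or_gt_of_ne hab with h' | h'
  · exact main a b h' l hl hlm h
  · apply main b a h' l hl (by rwa [M.symmetric])
    rw [← inv_inj, ← inv_pow, mul_inv_rev, CoxeterSystem.inv_simple, CoxeterSystem.inv_simple, h,
      inv_one]

end rep
end CoxPf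
namespace CoxPf
open Finset
section gf
variable {B W : Type*} [Group W] [Finite B] {M : CoxeterMatrix B} (cs : CoxeterSystem M W)

theorem sph_finite (k : ℕ) : {w : W | cs.length w = k}.Finite := by
  refine ((List.finite_length_eq B k).image cs.wordProd).subset ?_
  rintro w hw
  obtain ⟨ω, hω, rfl⟩ := cs.exists_isReduced w
  exact ⟨ω, by simpa [hω.eq] using hw, rfl⟩

noncomputable def sph (k : ℕ) : Finset W := (sph_finite cs k).toFinset

theorem mem_sph {k : ℕ} {w : W} : w ∈ sph cs k ↔ cs.length w = k := by simp [sph]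

open Classical in
noncomputable def gf (p : W → Prop) : PowerSeries ℤ :=
  PowerSeries.mk fun k => ∑ w ∈ sph cs k, if p w then (1 : ℤ) else 0

theorem gf_shift (p q : W → Prop) (u : W) (m : ℕ)
    (h1 : ∀ w, p w → q (w * u) ∧ cs.length (w * u) = cs.length w + m)
    (h2 : ∀ w, q w → p (w * u⁻¹)) : gf cs q = PowerSeries.X ^ m * gf cs p := by
  classical
  ext k
  rw [PowerSeries.coeff_X_pow_mul']
  simp only [gf, PowerSeries.coeff_mk]
  have hlen : ∀ w, q w → cs.length w = cs.length (w * u⁻¹) + m := by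
    intro w hw
    have := (h1 _ (h2 w hw)).2
    simpa using this
  split_ifs with hk
  · rw [← Finset.sum_filter, ← Finset.sum_filter]
    refine Finset.sum_bij' (fun w _ => w * u⁻¹) (fun w _ => w * u) ?_ ?_ ?_ ?_ ?_
    · intro w hw
      rw [mem_filter, mem_sph] at hw ⊢
      exact ⟨by have := hlen w hw.2; omega, h2 w hw.2⟩
    · intro w hw
      rw [mem_filter, mem_sph] at hw ⊢
      exact ⟨by have := (h1 w hw.2).2; omega, (h1 w hw.2).1⟩
    · intros; simp
    · intros; simp
    · intros; rfl
  · apply Finset.sum_eq_zero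
    intro w hw
    rw [mem_sph] at hw
    rw [if_neg]
    intro hq
    have := hlen w hq
    omega

variable {cs}

theorem gf_desc (i : B) : (1 + PowerSeries.X) * gf cs (fun w => cs.IsRightDescent w i) =
    PowerSeries.X * gf cs (fun _ => True) := by
  classical
  have h1 := gf_shift cs (fun w => ¬ cs.IsRightDescent w i) (fun w => cs.IsRightDescent w i)
    (cs.simple i) 1 (fun w hw => ⟨by
      rw [cs.isRightDescent_iff_not_isRightDescent_mul, cs.simple_mul_simple_cancel_right]
      exact hw, cs.not_isRightDescent_iff.1 hw⟩)
    (fun w hw => by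
      rw [cs.inv_simple]; exact cs.isRightDescent_iff_not_isRightDescent_mul.1 hw)
  have h2 : gf cs (fun _ => True) = gf cs (fun w => cs.IsRightDescent w i) +
      gf cs (fun w => ¬ cs.IsRightDescent w i) := by
    ext k
    simp only [gf, map_add, PowerSeries.coeff_mk, ← Finset.sum_add_distrib]
    apply Finset.sum_congr rfl
    intro w _
    by_cases h : cs.IsRightDescent w i <;> simp [h]
  rw [pow_one] at h1
  rw [h2]
  linear_combination h1

theorem gf_both (ho : OrdOK cs) {a b : B} (hab : a ≠ b) :
    (M a b = 0 → gf cs (fun w => cs.IsRightDescent w a ∧ cs.IsRightDescent w b) = 0) ∧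
    (M a b ≠ 0 → (1 + PowerSeries.X) * (1 - PowerSeries.X ^ M a b) *
      gf cs (fun w => cs.IsRightDescent w a ∧ cs.IsRightDescent w b) =
      PowerSeries.X ^ M a b * (1 - PowerSeries.X) * gf cs (fun _ => True)) := by
  classical
  constructor
  · intro h0
    ext k
    simp only [gf, PowerSeries.coeff_mk, map_zero]
    apply Finset.sum_eq_zero
    intro w _
    rw [if_neg]
    rintro ⟨h1, h2⟩
    exact (R5 ho hab h1 h2).1 h0
  · intro h0
    have h1 := gf_shift cs (fun w => ¬ cs.IsRightDescent w a ∧ ¬ cs.IsRightDescent w b)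
      (fun w => cs.IsRightDescent w a ∧ cs.IsRightDescent w b)
      (altG cs.simple a b (M a b)) (M a b) (fun w hw => by
        have hv := R4 ho hab hw.1 hw.2
        exact ⟨R6 ho hab hv h0, Rlen ho hab hv (by omega)⟩)
      (fun w hw => by
        obtain ⟨-, v, hv, rfl⟩ := R5 ho hab hw.1 hw.2
        rw [mul_inv_cancel_right]
        have e1 := R1 ho hab hv (k := 0) (by omega)
        have e2 := R1 ho hab.symm hv.symm (k := 0) (by rw [M.symmetric]; omega)
        rw [altG_zero, mul_one] at e1 e2
        exact ⟨e1, e2⟩)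
    have h2 : gf cs (fun w => ¬ cs.IsRightDescent w a ∧ ¬ cs.IsRightDescent w b) =
        gf cs (fun _ => True) - gf cs (fun w => cs.IsRightDescent w a) -
        gf cs (fun w => cs.IsRightDescent w b) +
        gf cs (fun w => cs.IsRightDescent w a ∧ cs.IsRightDescent w b) := by
      ext k
      simp only [gf, map_add, map_sub, PowerSeries.coeff_mk, ← Finset.sum_add_distrib,
        ← Finset.sum_sub_distrib]
      apply Finset.sum_congr rfl
      intro w _
      by_cases h : cs.IsRightDescent w a <;> by_cases h' : cs.IsRightDescent w b <;> simp [h, h']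
    rw [h2] at h1
    have d1 := gf_desc (cs := cs) a
    have d2 := gf_desc (cs := cs) b
    linear_combination (1 + PowerSeries.X) * h1 - PowerSeries.X ^ M a b * (d1 + d2)

end gf

section final
variable {n : ℕ}

open Classical in
theorem count_aux (D : Fin n → Prop)
    (h3 : ∀ a b c, a ≠ b → b ≠ c → a ≠ c → D a → D b → D c → False) :
    (1 : ℤ) - ∑ i, (if D i then 1 else 0) +
      ∑ p : {p : Fin n × Fin n // p.2 < p.1}, (if D p.1.1 ∧ D p.1.2 then 1 else 0) =
      if ∃ i, D i then 0 else 1 := by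
  by_cases h : ∃ i, D i
  · rw [if_pos h]
    obtain ⟨a, ha⟩ := h
    by_cases h' : ∃ b, b ≠ a ∧ D b
    · have main : ∀ a b : Fin n, b < a → D a → D b → (1 : ℤ) - ∑ i, (if D i then 1 else 0) +
        ∑ p : {p : Fin n × Fin n // p.2 < p.1}, (if D p.1.1 ∧ D p.1.2 then 1 else 0) = 0 := by
        intro a b hab ha hb
        have hD : ∀ c, D c ↔ c = a ∨ c = b := by
          intro c
          constructor
          · intro hc
            by_contra hn
            push Not at hn
            exact h3 a b c hab.ne' hn.2.symm hn.1.symm ha hb hc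
          · rintro (rfl | rfl) <;> assumption
        have e1 : ∑ i, (if D i then (1 : ℤ) else 0) = 2 := by
          rw [← Finset.sum_filter, Finset.sum_const]
          have : Finset.univ.filter D = {a, b} := by ext c; simp [hD]
          rw [this, Finset.card_pair hab.ne']; simp
        have e2 : ∑ p : {p : Fin n × Fin n // p.2 < p.1},
            (if D p.1.1 ∧ D p.1.2 then (1 : ℤ) else 0) = 1 := by
          rw [Finset.sum_eq_single ⟨(a, b), hab⟩]
          · simp [ha, hb]
          · rintro ⟨⟨c, d⟩, hcd⟩ _ hne
            rw [if_neg]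
            simp only [hD]
            rintro ⟨h1 | h1, h2 | h2⟩ <;> dsimp at h1 h2 hcd <;> subst h1 <;> subst h2
            · exact lt_irrefl _ hcd
            · exact hne rfl
            · exact lt_asymm hcd hab
            · exact lt_irrefl _ hcd
          · simp
        rw [e1, e2]; norm_num
      obtain ⟨b, hba, hb⟩ := h'
      rcases lt_or_gt_of_ne hba with h | h
      · exact main a b h ha hb
      · exact main b a h hb ha
    · push Not at h'
      have hD : ∀ c, D c ↔ c = a := fun c =>
        ⟨fun hc => by by_contra hn; exact h' c hn hc, fun hc => hc ▸ ha⟩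
      simp only [hD]
      have e2 : ∑ p : {p : Fin n × Fin n // p.2 < p.1},
            (if p.1.1 = a ∧ p.1.2 = a then (1 : ℤ) else 0) = 0 := by
        apply Finset.sum_eq_zero
        rintro ⟨⟨c, d⟩, hcd⟩ _
        rw [if_neg]
        rintro ⟨h1, h2⟩
        dsimp at h1 h2 hcd
        subst h1; subst h2; exact lt_irrefl _ hcd
      rw [e2]; simp
  · rw [if_neg h]
    push Not at h
    simp [h]

noncomputable def dfac : PowerSeries ℤ :=
  PowerSeries.X * Ring.inverse (1 + PowerSeries.X)

noncomputable def cfac (m : ℕ) : PowerSeries ℤ :=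
  if m = 0 then 0 else
    PowerSeries.X ^ m * (1 - PowerSeries.X) *
      Ring.inverse ((1 + PowerSeries.X) * (1 - PowerSeries.X ^ m))

theorem unit1 : IsUnit (1 + PowerSeries.X : PowerSeries ℤ) := by
  rw [PowerSeries.isUnit_iff_constantCoeff]; simp

theorem unit2 {m : ℕ} (hm : m ≠ 0) :
    IsUnit ((1 + PowerSeries.X) * (1 - PowerSeries.X ^ m) : PowerSeries ℤ) := by
  rw [PowerSeries.isUnit_iff_constantCoeff]; simp [hm]

theorem eq_of_unit {R : Type*} [CommRing R] {u x y w : R} (hu : IsUnit u) (h : u * x = y * w) :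
    x = y * Ring.inverse u * w := by
  apply hu.mul_left_cancel
  rw [h]
  linear_combination -(y * w) * Ring.mul_inverse_cancel u hu

noncomputable def tot (M : CoxeterMatrix (Fin n)) : PowerSeries ℤ :=
  1 - ∑ _i : Fin n, dfac +
    ∑ p : {p : Fin n × Fin n // p.2 < p.1}, cfac (M p.1.1 p.1.2)

theorem poincare_mul (M : CoxeterMatrix (Fin n))
    (hM : ∀ i j : Fin n, i ≠ j → M i j = 3 ∨ M i j = 4 ∨ M i j = 6 ∨ M i j = 0) :
    tot M * coxPoincare M = 1 := by
  classical
  have ho := ordOK M hM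
  set cs := M.toCoxeterSystem with hcs
  have hm : ∀ a b, a ≠ b → M a b ≠ 1 ∧ M a b ≠ 2 := by
    intro a b hab
    have := hM a b hab
    omega
  have hW : coxPoincare M = gf cs (fun _ => True) := by
    ext k
    simp only [coxPoincare, gf, PowerSeries.coeff_mk, if_true]
    rw [Finset.sum_const, nsmul_eq_mul, mul_one,
      ← Nat.subtype_card (sph cs k) (fun w => mem_sph cs)]
  have h1 : (1 : PowerSeries ℤ) = gf cs (fun _ => True) -
      ∑ i, gf cs (fun w => cs.IsRightDescent w i) +
      ∑ p : {p : Fin n × Fin n // p.2 < p.1},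
        gf cs (fun w => cs.IsRightDescent w p.1.1 ∧ cs.IsRightDescent w p.1.2) := by
    ext k
    simp only [gf, map_add, map_sub, map_sum, PowerSeries.coeff_mk]
    rw [Finset.sum_comm, Finset.sum_comm (s := Finset.univ), ← Finset.sum_sub_distrib,
      ← Finset.sum_add_distrib]
    have : ∀ w ∈ sph cs k, ((if True then (1 : ℤ) else 0) -
        ∑ i, (if cs.IsRightDescent w i then 1 else 0) +
        ∑ p : {p : Fin n × Fin n // p.2 < p.1},
          (if cs.IsRightDescent w p.1.1 ∧ cs.IsRightDescent w p.1.2 then 1 else 0)) =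
        if w = 1 then 1 else 0 := by
      intro w _
      rw [if_pos trivial, count_aux (fun i => cs.IsRightDescent w i)
        (fun a b c hab hbc hac ha hb hc => C4 ho hm hab hbc hac ha hb hc)]
      by_cases hw : w = 1
      · subst hw
        simp [cs.not_isRightDescent_one]
      · rw [if_pos (cs.exists_rightDescent_of_ne_one hw), if_neg hw]
    symm
    trans ∑ w ∈ sph cs k, if w = 1 then (1 : ℤ) else 0
    · apply Finset.sum_congr rfl
      intro w hw
      convert this w hw
    · rw [PowerSeries.coeff_one, Finset.sum_ite_eq']
      simp [mem_sph, eq_comm]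
  rw [hW]
  conv_rhs => rw [h1]
  have e1 : ∀ i, gf cs (fun w => cs.IsRightDescent w i) =
      dfac * gf cs (fun _ => True) := fun i =>
    eq_of_unit unit1 (gf_desc i)
  have e2 : ∀ p : {p : Fin n × Fin n // p.2 < p.1},
      gf cs (fun w => cs.IsRightDescent w p.1.1 ∧ cs.IsRightDescent w p.1.2) =
        cfac (M p.1.1 p.1.2) * gf cs (fun _ => True) := by
    rintro ⟨⟨a, b⟩, hab⟩
    have := gf_both ho (a := a) (b := b) (ne_of_gt hab)
    by_cases h0 : M a b = 0
    · simp [cfac, h0, this.1 h0]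
    · simp only [cfac, h0, if_false]
      exact eq_of_unit (unit2 h0) (this.2 h0)
  simp only [e1, e2, ← Finset.sum_mul]
  rw [tot]; ring

end final
end CoxPf

/-- if two Coxeter matrices on `{1, …, n}` have all off-diagonal entries
in `{3, 4, 6, ∞}` (with `∞` encoded as `0`) and their multisets of below-diagonal
entries coincide (witnessed by a bijection `φ` of below-diagonal positions), then
their Poincaré series are equal. -/
theorem poincare_eq_of_entry_permutation {n : ℕ}
    (M M' : CoxeterMatrix (Fin n))
    (hM : ∀ i j : Fin n, i ≠ j → M i j = 3 ∨ M i j = 4 ∨ M i j = 6 ∨ M i j = 0)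
    (hM' : ∀ i j : Fin n, i ≠ j → M' i j = 3 ∨ M' i j = 4 ∨ M' i j = 6 ∨ M' i j = 0)
    (φ : {p : Fin n × Fin n // p.2 < p.1} ≃ {p : Fin n × Fin n // p.2 < p.1})
    (hφ : ∀ p : {p : Fin n × Fin n // p.2 < p.1},
      M' p.1.1 p.1.2 = M (φ p).1.1 (φ p).1.2) :
    coxPoincare M = coxPoincare M' := by
  have h1 := CoxPf.poincare_mul M hM
  have h2 := CoxPf.poincare_mul M' hM'
  have h3 : CoxPf.tot M' = CoxPf.tot M := by
    unfold CoxPf.tot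
    congr 1
    rw [← Equiv.sum_comp φ (fun p => CoxPf.cfac (M p.1.1 p.1.2))]
    exact Finset.sum_congr rfl fun p _ => by rw [hφ]
  rw [h3] at h2
  exact left_inv_eq_right_inv (by rw [mul_comm]; exact h1) h2
end
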